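/- arXiv:1605.09601 — 3 statements merged into one kernel-verified Lean document; each statement's English description precedes it below -/
import Mathlib

section
/- Fix ρ > 1. There exist constants A, B > 0 depending only on ρ such that the following holds (oversampled regime). Let Q > 0 and 0 < ε < Q with log(Q/ε)/log(ρ) < (1/2)√N for a positive integer N. Let f be given on [-1, (ρ+ρ⁻¹)/2) by a Chebyshev series f(x) = Σ_{n≥0} a_n T_n(x) whose coefficients satisfy |a_0| ≤ Q and |a_n| ≤ 2Q ρ^{-n} for n ≥ 1 (the series converges absolutely on this interval). Let ε_vec ∈ ℝ^{N+1} satisfy ‖ε_vec‖_∞ ≤ ε, set M* = ⌊log(Q/ε)/log ρ⌋, let c ∈ ℝ^{M*+1} solve the normal equations T_{M*}(x^{equi})ᵀ T_{M*}(x^{equi}) c = T_{M*}(x^{equi})ᵀ (f(x^{equi}) + ε_vec), and let e(x) = Σ_{k=0}^{M*} c_k T_k(x). Then for every x ∈ [1, (ρ+ρ⁻¹)/2), with r(x) = (x + √(x²−1))/ρ, one has |f(x) − e(x)| ≤ A (1 + log(Q/ε))^B · (Q/(1 − r(x))) · (ε/Q)^{−log r(x)/log ρ}. -/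
open Matrix MeasureTheory
open scoped BigOperators

/-- Chebyshev polynomial of the first kind `T_n`, as a function `ℝ → ℝ`. -/
noncomputable def cheb (n : ℕ) (x : ℝ) : ℝ :=
  (Polynomial.Chebyshev.T ℝ (n : ℤ)).eval x

/-- The equally spaced grid `x_k = 2k/N - 1`, `k = 0, …, N`, on `[-1,1]`. -/
noncomputable def xequi (N : ℕ) (k : Fin (N + 1)) : ℝ :=
  2 * (k : ℝ) / (N : ℝ) - 1

/-- The `(N+1) × (M+1)` Chebyshev–Vandermonde matrix at the equally spaced grid. -/
noncomputable def chebVand (N M : ℕ) : Matrix (Fin (N + 1)) (Fin (M + 1)) ℝ :=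
  Matrix.of fun i j => cheb (j : ℕ) (xequi N i)

/-- The Euclidean norm of a vector in `ℝ^n`. -/
noncomputable def enorm2 {n : ℕ} (v : Fin n → ℝ) : ℝ :=
  Real.sqrt (∑ i, (v i) ^ 2)

/-- The smallest singular value of a matrix, as the infimum of `‖A v‖₂` over unit vectors. -/
noncomputable def sigmaMin {m n : ℕ} (A : Matrix (Fin m) (Fin n) ℝ) : ℝ :=
  sInf {r | ∃ v : Fin n → ℝ, enorm2 v = 1 ∧ r = enorm2 (A.mulVec v)}

/-- The largest singular value of a matrix, as the supremum of `‖A v‖₂` over unit vectors. -/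
noncomputable def sigmaMax {m n : ℕ} (A : Matrix (Fin m) (Fin n) ℝ) : ℝ :=
  sSup {r | ∃ v : Fin n → ℝ, enorm2 v = 1 ∧ r = enorm2 (A.mulVec v)}

namespace Polynomial.Chebyshev

theorem abs_eval_iterate_derivative_le {n : ℕ} {P : Polynomial ℝ} {m : ℝ} (k : ℕ) {x : ℝ}
    (hx : 1 ≤ x) (hm : 0 < m) (hdeg : P.degree ≤ n)
    (hP : ∀ y ∈ Set.Icc (-1 : ℝ) 1, |P.eval y| ≤ m) :
    |(derivative^[k] P).eval x| ≤ m * (derivative^[k] (T ℝ n)).eval x := by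
  have key : ∀ s : ℝ, |s| = 1 →
      s * (derivative^[k] P).eval x ≤ m * (derivative^[k] (T ℝ n)).eval x := by
    intro s hs
    have h := eval_iterate_derivative_le_of_forall_abs_le_one (n := n) (P := (s / m) • P) (k := k)
      hx ((degree_smul_le _ _).trans hdeg) (by
        intro y hy
        rw [eval_smul, smul_eq_mul, abs_mul, abs_div, hs, abs_of_pos hm, one_div,
          inv_mul_le_one₀ hm]
        exact hP y hy)
    rw [iterate_derivative_smul, eval_smul, smul_eq_mul, div_mul_eq_mul_div, div_le_iff₀ hm] at h
    linarith
  rw [abs_le']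
  exact ⟨by simpa using key 1 (by simp), by simpa using key (-1) (by simp)⟩

theorem abs_eval_derivative_le_of_nonneg {n : ℕ} {P : Polynomial ℝ} {m : ℝ} (hm : 0 < m)
    (hdeg : P.degree ≤ n) (hP : ∀ y ∈ Set.Icc (-1 : ℝ) 1, |P.eval y| ≤ m) {x : ℝ}
    (hx : x ∈ Set.Icc (0 : ℝ) 1) : |P.derivative.eval x| ≤ 2 * n ^ 2 * m := by
  obtain ⟨hx0, hx1⟩ := hx
  set L : Polynomial ℝ := Polynomial.C ((x + 1) / 2) * X + Polynomial.C ((x - 1) / 2) with hL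
  have hLe : ∀ y, L.eval y = (x + 1) / 2 * y + (x - 1) / 2 := by intro y; simp [hL]
  have hcomp : (P.comp L).degree ≤ n := by
    rw [← natDegree_le_iff_degree_le] at hdeg ⊢
    have hL1 : L.natDegree ≤ 1 := natDegree_linear_le
    calc (P.comp L).natDegree ≤ P.natDegree * L.natDegree := natDegree_comp_le
      _ ≤ n * 1 := Nat.mul_le_mul hdeg hL1
      _ = n := mul_one n
  have h := abs_eval_iterate_derivative_le (P := P.comp L) 1 le_rfl hm hcomp (by
    intro y hy
    rw [eval_comp, hLe]
    exact hP _ ⟨by nlinarith [hy.1, hy.2], by nlinarith [hy.1, hy.2]⟩)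
  have hT := iterate_derivative_T_eval_one (R := ℝ) n 1
  have hT' : (derivative (T ℝ n)).eval 1 = (n : ℝ) ^ 2 := by simpa using hT
  simp only [Function.iterate_one] at h
  have hL1 : L.eval 1 = x := by rw [hLe]; ring
  have hLd : L.derivative.eval 1 = (x + 1) / 2 := by simp [hL]
  rw [derivative_comp, eval_mul, eval_comp, hL1, hLd, hT', abs_mul, abs_of_nonneg (by linarith :
    0 ≤ (x + 1) / 2)] at h
  nlinarith [abs_nonneg (P.derivative.eval x)]

/-- A form of Markov's inequality for the derivative of a polynomial, with a non-optimal
constant. -/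
theorem abs_eval_derivative_le {n : ℕ} {P : Polynomial ℝ} {m : ℝ} (hm : 0 < m)
    (hdeg : P.degree ≤ n) (hP : ∀ y ∈ Set.Icc (-1 : ℝ) 1, |P.eval y| ≤ m) {x : ℝ}
    (hx : x ∈ Set.Icc (-1 : ℝ) 1) : |P.derivative.eval x| ≤ 2 * n ^ 2 * m := by
  obtain h0 | h0 := le_total 0 x
  · exact abs_eval_derivative_le_of_nonneg hm hdeg hP ⟨h0, hx.2⟩
  · have hcomp : (P.comp (-X)).degree ≤ n := by
      rw [← natDegree_le_iff_degree_le] at hdeg ⊢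
      simpa [natDegree_comp] using hdeg
    have h := abs_eval_derivative_le_of_nonneg (P := P.comp (-X)) (x := -x) hm hcomp (by
      intro y hy
      rw [eval_comp]
      simpa using hP (-y) ⟨by linarith [hy.2], by linarith [hy.1]⟩) ⟨by linarith, by linarith [hx.1]⟩
    simpa [derivative_comp, eval_comp] using h

theorem eval_T_real_le_pow (n : ℕ) {x : ℝ} (hx : 1 ≤ x) :
    (T ℝ n).eval x ≤ (x + √(x ^ 2 - 1)) ^ n := by
  have hs : √(x ^ 2 - 1) ^ 2 = x ^ 2 - 1 := Real.sq_sqrt (by nlinarith)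
  have hs0 : 0 ≤ √(x ^ 2 - 1) := Real.sqrt_nonneg _
  set w := x + √(x ^ 2 - 1) with hw
  have hw1 : 1 ≤ w := by linarith
  have hw0 : 0 < w := by linarith
  have hinv : w⁻¹ = x - √(x ^ 2 - 1) := by
    rw [inv_eq_iff_eq_inv, eq_comm, inv_eq_of_mul_eq_one_left]
    rw [hw]; nlinarith
  have hcosh : x = Real.cosh (Real.log w) := by
    rw [Real.cosh_log hw0, hinv, hw]; ring
  calc (T ℝ n).eval x = Real.cosh (n * Real.log w) := by
        conv_lhs => rw [hcosh]
        exact_mod_cast T_real_cosh (Real.log w) n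
    _ ≤ Real.exp (n * Real.log w) := by
        rw [Real.cosh_eq]
        have : Real.exp (-(n * Real.log w)) ≤ Real.exp (n * Real.log w) := by
          apply Real.exp_le_exp.2
          have : 0 ≤ n * Real.log w := mul_nonneg n.cast_nonneg (Real.log_nonneg hw1)
          linarith
        linarith
    _ = w ^ n := by rw [Real.exp_nat_mul, Real.exp_log hw0]

end Polynomial.Chebyshev

/-- Lower bound for the number of grid points `0, …, N` within distance `R` of `t ∈ [0, N]`. -/
theorem le_two_mul_card_filter_abs_sub_le {N : ℕ} {t R : ℝ} (ht0 : 0 ≤ t) (htN : t ≤ N)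
    (hR : 1 / 2 ≤ R) (hRN : R ≤ N) :
    R ≤ 2 * ((Finset.univ.filter fun k : Fin (N + 1) => |(k : ℝ) - t| ≤ R).card : ℝ) := by
  set S := Finset.univ.filter fun k : Fin (N + 1) => |(k : ℝ) - t| ≤ R
  set b := ⌊min (N : ℝ) (t + R)⌋₊
  set a := ⌈max 0 (t - R)⌉₊
  have hb0 : 0 ≤ min (N : ℝ) (t + R) := le_min (by positivity) (by linarith)
  have hb : (b : ℝ) ≤ min (N : ℝ) (t + R) := Nat.floor_le hb0
  have hb' : min (N : ℝ) (t + R) < b + 1 := Nat.lt_floor_add_one _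
  have ha : max 0 (t - R) ≤ a := Nat.le_ceil _
  have ha' : (a : ℝ) < max 0 (t - R) + 1 := Nat.ceil_lt_add_one (le_max_left _ _)
  have hcard : b + 1 - a ≤ S.card := by
    rw [← Nat.card_Icc, ← Finset.card_map Fin.valEmbedding]
    apply Finset.card_le_card
    intro k hk
    rw [Finset.mem_Icc] at hk
    have h1 : (a : ℝ) ≤ k := by exact_mod_cast hk.1
    have h2 : (k : ℝ) ≤ b := by exact_mod_cast hk.2
    have h3 : (k : ℝ) ≤ N := h2.trans (hb.trans (min_le_left _ _))
    have h4 : k < N + 1 := by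
      have : k ≤ N := by exact_mod_cast h3
      omega
    rw [Finset.mem_map]
    refine ⟨⟨k, h4⟩, ?_, rfl⟩
    simp only [S, Finset.mem_filter, Finset.mem_univ, true_and]
    rw [abs_le]
    exact ⟨by linarith [le_max_right 0 (t - R)], by linarith [min_le_right (N : ℝ) (t + R)]⟩
  have hpos : a ≤ b := by
    have hr := abs_le.1 (abs_sub_round t)
    have hr0 : 0 ≤ round t := by
      by_contra! h
      have : (round t : ℝ) ≤ -1 := by exact_mod_cast (by omega : round t ≤ -1)
      linarith
    obtain ⟨k, hk⟩ := Int.eq_ofNat_of_zero_le hr0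
    have hk' : (round t : ℝ) = k := by rw [hk]; simp
    rw [hk'] at hr
    have hkN : (k : ℝ) ≤ N := by
      by_contra! h
      have : (N : ℝ) + 1 ≤ k := by exact_mod_cast h
      linarith
    have h1 : a ≤ k := Nat.ceil_le.2 (max_le (by positivity) (by linarith))
    have h2 : k ≤ b := Nat.le_floor (le_min hkN (by linarith))
    exact h1.trans h2
  have hc1 : (1 : ℝ) ≤ S.card := by exact_mod_cast (by omega : 1 ≤ S.card)
  have hc2 : (b : ℝ) + 1 - a ≤ S.card := by
    have : b + 1 ≤ S.card + a := by omega
    have : (b : ℝ) + 1 ≤ S.card + a := by exact_mod_cast this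
    linarith
  have hlen : R ≤ min (N : ℝ) (t + R) - max 0 (t - R) := by
    rcases min_cases (N : ℝ) (t + R) with h | h <;> rcases max_cases 0 (t - R) with h' | h' <;>
      linarith
  linarith

theorem abs_xequi_le_one {N : ℕ} (hN : 0 < N) (k : Fin (N + 1)) : |xequi N k| ≤ 1 := by
  have hN' : (0 : ℝ) < N := by exact_mod_cast hN
  have hkN : (k : ℝ) ≤ N := by exact_mod_cast Nat.lt_succ_iff.1 k.2
  have h1 : 0 ≤ 2 * (k : ℝ) / N := by positivity
  have h2 : 2 * (k : ℝ) / N ≤ 2 := by rw [div_le_iff₀ hN']; linarith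
  rw [abs_le, xequi]
  constructor <;> linarith

/-- If a polynomial of degree at most `n < √N / 2` is bounded by `D` in root mean square on the
equally spaced grid, it is bounded by `12 (n + 1) D` on `[-1, 1]`. -/
theorem abs_eval_le_of_sum_sq_xequi_le {n N : ℕ} (hN : 0 < N) (hn : 4 * (n : ℝ) ^ 2 < N)
    {P : Polynomial ℝ} (hdeg : P.degree ≤ n) {D : ℝ} (hD : 0 ≤ D)
    (hsum : ∑ i, P.eval (xequi N i) ^ 2 ≤ (N + 1) * D ^ 2) {x : ℝ} (hx : x ∈ Set.Icc (-1 : ℝ) 1) :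
    |P.eval x| ≤ 12 * (n + 1) * D := by
  have hN1 : (1 : ℝ) ≤ N := by exact_mod_cast hN
  rcases Nat.eq_zero_or_pos n with rfl | hn0
  · have hc := Polynomial.eq_C_of_degree_le_zero (by simpa using hdeg)
    rw [hc] at hsum ⊢
    simp only [Polynomial.eval_C, Finset.sum_const, Finset.card_univ, Fintype.card_fin,
      nsmul_eq_mul] at hsum ⊢
    push_cast at hsum ⊢
    have : |P.coeff 0| ≤ D := abs_le_of_sq_le_sq (le_of_mul_le_mul_left hsum (by linarith)) hD
    linarith
  have hn1 : (1 : ℝ) ≤ n := by exact_mod_cast hn0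
  obtain ⟨x₀, hx₀, hmax⟩ := isCompact_Icc.exists_isMaxOn (Set.nonempty_Icc.2 (by norm_num))
    (P.continuous.abs.continuousOn (s := Set.Icc (-1 : ℝ) 1))
  have hmax' : ∀ y ∈ Set.Icc (-1 : ℝ) 1, |P.eval y| ≤ |P.eval x₀| := fun y hy => hmax hy
  set m := |P.eval x₀| with hm
  refine (hmax' x hx).trans ?_
  rcases (abs_nonneg (P.eval x₀)).eq_or_lt with h0 | hpos
  · rw [← hm] at h0
    rw [← h0]; positivity
  rw [← hm] at hpos
  have hlip : ∀ y ∈ Set.Icc (-1 : ℝ) 1, |P.eval y - P.eval x₀| ≤ 2 * n ^ 2 * m * |y - x₀| := by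
    intro y hy
    have := (convex_Icc (-1 : ℝ) 1).norm_image_sub_le_of_norm_hasDerivWithin_le
      (f := fun z => P.eval z) (f' := fun z => P.derivative.eval z) (C := 2 * n ^ 2 * m)
      (fun z _ => (P.hasDerivAt z).hasDerivWithinAt)
      (fun z hz => Polynomial.Chebyshev.abs_eval_derivative_le hpos hdeg hmax' hz) hx₀ hy
    simpa [Real.norm_eq_abs] using this
  set R : ℝ := N / (8 * n ^ 2) with hR
  have hR2 : 8 * n ^ 2 * R = N := by rw [hR]; field_simp
  have hcard := le_two_mul_card_filter_abs_sub_le (N := N) (t := (x₀ + 1) * N / 2) (R := R)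
    (by have := hx₀.1; apply div_nonneg (mul_nonneg _ _) <;> linarith)
    (by have := hx₀.2; nlinarith)
    (by rw [hR, le_div_iff₀ (by positivity)]; linarith)
    (by rw [hR]; apply div_le_self (by positivity); nlinarith)
  set S := Finset.univ.filter fun k : Fin (N + 1) => |(k : ℝ) - (x₀ + 1) * N / 2| ≤ R
  have hlow : ∀ k ∈ S, (m / 2) ^ 2 ≤ P.eval (xequi N k) ^ 2 := by
    intro k hk
    have hk' : |(k : ℝ) - (x₀ + 1) * N / 2| ≤ R := by simpa [S] using hk
    have hy : xequi N k ∈ Set.Icc (-1 : ℝ) 1 := abs_le.1 (abs_xequi_le_one hN k)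
    have hdist : |xequi N k - x₀| = 2 / N * |(k : ℝ) - (x₀ + 1) * N / 2| := by
      have : xequi N k - x₀ = 2 / N * ((k : ℝ) - (x₀ + 1) * N / 2) := by
        simp only [xequi]; field_simp; ring
      rw [this, abs_mul, abs_of_nonneg (by positivity : (0 : ℝ) ≤ 2 / N)]
    have h1 : |P.eval (xequi N k) - P.eval x₀| ≤ m / 2 := by
      refine (hlip _ hy).trans ?_
      rw [hdist]
      calc 2 * n ^ 2 * m * (2 / N * |(k : ℝ) - (x₀ + 1) * N / 2|)
          ≤ 2 * n ^ 2 * m * (2 / N * R) := by gcongr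
        _ = m / 2 := by rw [hR]; field_simp; norm_num
    have h2 : m / 2 ≤ |P.eval (xequi N k)| := by
      have := abs_sub_abs_le_abs_sub (P.eval x₀) (P.eval (xequi N k))
      rw [abs_sub_comm, ← hm] at this
      linarith
    rw [← sq_abs (P.eval _)]
    gcongr
  have h1 : S.card * (m / 2) ^ 2 ≤ (N + 1) * D ^ 2 := by
    refine le_trans ?_ hsum
    rw [← nsmul_eq_mul]
    exact (Finset.card_nsmul_le_sum S _ _ hlow).trans
      (Finset.sum_le_sum_of_subset_of_nonneg (Finset.subset_univ S) fun i _ _ => sq_nonneg _)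
  have h2 : R / 2 * (m / 2) ^ 2 ≤ 2 * N * D ^ 2 := by
    calc R / 2 * (m / 2) ^ 2 ≤ S.card * (m / 2) ^ 2 := by gcongr; linarith
      _ ≤ (N + 1) * D ^ 2 := h1
      _ ≤ 2 * N * D ^ 2 := by gcongr; linarith
  have hRpos : 0 < R := by positivity
  have h3 : m ^ 2 ≤ 128 * n ^ 2 * D ^ 2 := by
    rw [← hR2] at h2
    refine le_of_mul_le_mul_left ?_ hRpos
    nlinarith
  refine le_of_sq_le_sq ?_ (by positivity)
  nlinarith [mul_nonneg (by positivity : (0 : ℝ) ≤ n) (sq_nonneg D), sq_nonneg D, sq_nonneg ((n : ℝ) * D)]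

theorem abs_sub_sum_mul_le_of_hasSum {Q ρ w F : ℝ} {a g : ℕ → ℝ} (hQ : 0 < Q) (hρ : 0 < ρ)
    (hw : 0 < w) (hwρ : w < ρ) (ha : ∀ n : ℕ, 1 ≤ n → |a n| ≤ 2 * Q * ρ ^ (-(n : ℤ)))
    (hg : ∀ n, |g n| ≤ w ^ n) (hF : HasSum (fun n => a n * g n) F) (M : ℕ) :
    |F - ∑ k : Fin (M + 1), a k * g k| ≤ 2 * Q * (w / ρ) ^ (M + 1) * (1 - w / ρ)⁻¹ := by
  rw [Fin.sum_univ_eq_sum_range (fun k => a k * g k) (M + 1)]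
  have h1 := (hasSum_nat_add_iff' (M + 1)).2 hF
  have h2 := (hasSum_geometric_of_lt_one (div_pos hw hρ).le ((div_lt_one hρ).2 hwρ)).mul_left
    (2 * Q * (w / ρ) ^ (M + 1))
  have hb : ∀ n, ‖a (n + (M + 1)) * g (n + (M + 1))‖ ≤
      2 * Q * (w / ρ) ^ (M + 1) * (w / ρ) ^ n := by
    intro n
    rw [Real.norm_eq_abs, abs_mul]
    calc |a (n + (M + 1))| * |g (n + (M + 1))|
        ≤ (2 * Q * ρ ^ (-((n + (M + 1) : ℕ) : ℤ))) * w ^ (n + (M + 1)) :=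
          mul_le_mul (ha _ (by omega)) (hg _) (abs_nonneg _) (by positivity)
      _ = 2 * Q * (w / ρ) ^ (M + 1) * (w / ρ) ^ n := by
          rw [_root_.zpow_neg, zpow_natCast, mul_assoc _ ((w / ρ) ^ _), ← pow_add, add_comm (M + 1),
            div_pow]
          ring
  exact h1.norm_le_of_bounded h2 hb

/-- A vector in the column space of `A` whose residual against `η` is orthogonal to that space is
no longer than `η`. -/
theorem Matrix.sum_mulVec_sq_le_of_normal_eq {m n : Type*} [Fintype m] [Fintype n]
    {A : Matrix m n ℝ} {d : n → ℝ} {η : m → ℝ} (h : (Aᵀ * A) *ᵥ d = Aᵀ *ᵥ η) :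
    ∑ i, (A *ᵥ d) i ^ 2 ≤ ∑ i, η i ^ 2 := by
  have h1 : (A *ᵥ d) ⬝ᵥ (A *ᵥ d) = (A *ᵥ d) ⬝ᵥ η := by
    have := congrArg (fun v => d ⬝ᵥ v) h
    simp only [← Matrix.mulVec_mulVec, Matrix.dotProduct_mulVec, Matrix.vecMul_transpose] at this
    simpa [Matrix.dotProduct_mulVec] using this
  simp only [dotProduct] at h1
  have h2 : ∑ i, (A *ᵥ d) i * η i ≤ ∑ i, ((A *ᵥ d) i ^ 2 / 2 + η i ^ 2 / 2) :=
    Finset.sum_le_sum fun i _ => by nlinarith [sq_nonneg ((A *ᵥ d) i - η i)]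
  rw [Finset.sum_add_distrib, ← Finset.sum_div, ← Finset.sum_div] at h2
  have h3 : ∑ i, (A *ᵥ d) i * (A *ᵥ d) i = ∑ i, (A *ᵥ d) i ^ 2 := by simp only [sq]
  linarith

theorem add_sqrt_sq_sub_one_lt {ρ x : ℝ} (hρ : 1 < ρ) (hx1 : 1 ≤ x) (hx : x < (ρ + ρ⁻¹) / 2) :
    x + √(x ^ 2 - 1) < ρ := by
  have hinv : ρ * ρ⁻¹ = 1 := mul_inv_cancel₀ (by linarith)
  have hinv1 : ρ⁻¹ < 1 := inv_lt_one_of_one_lt₀ hρ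
  have h : √(x ^ 2 - 1) < ρ - x := by
    rw [Real.sqrt_lt' (by linarith)]
    nlinarith
  linarith

/-- Error of the least squares Chebyshev fit of degree `M < √N / 2`, when the truncated Chebyshev
series matches the samples up to `D`. -/
theorem abs_sum_sub_sum_cheb_le {N M : ℕ} (hN : 0 < N) (hM : 4 * (M : ℝ) ^ 2 < N)
    {b c : Fin (M + 1) → ℝ} {y : Fin (N + 1) → ℝ} {D : ℝ} (hD : 0 < D)
    (hy : ∀ i, |y i - ∑ k, b k * cheb k (xequi N i)| ≤ D)
    (hc : ((chebVand N M).transpose * chebVand N M) *ᵥ c = (chebVand N M).transpose *ᵥ y)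
    {x : ℝ} (hx : 1 ≤ x) :
    |∑ k, b k * cheb k x - ∑ k, c k * cheb k x| ≤
      12 * (M + 1) * D * (x + √(x ^ 2 - 1)) ^ M := by
  set P : Polynomial ℝ := ∑ k : Fin (M + 1),
    (c k - b k) • Polynomial.Chebyshev.T ℝ ((k : ℕ) : ℤ) with hPdef
  have hPe : ∀ z, P.eval z = ∑ k, c k * cheb k z - ∑ k, b k * cheb k z := by
    intro z
    rw [hPdef, Polynomial.eval_finsetSum, ← Finset.sum_sub_distrib]
    refine Finset.sum_congr rfl fun k _ => ?_
    rw [Polynomial.eval_smul, smul_eq_mul, sub_mul, cheb]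
  have hdeg : P.degree ≤ M := by
    refine (Polynomial.degree_sum_le _ _).trans (Finset.sup_le fun k _ => ?_)
    refine (Polynomial.degree_smul_le _ _).trans ?_
    rw [Polynomial.Chebyshev.degree_T, Int.natAbs_natCast]
    exact_mod_cast Nat.lt_succ_iff.1 k.2
  have hmul : ∀ (v : Fin (M + 1) → ℝ) i,
      (chebVand N M *ᵥ v) i = ∑ k, v k * cheb k (xequi N i) := by
    intro v i
    simp [Matrix.mulVec, dotProduct, chebVand, mul_comm]
  have hnormal : ((chebVand N M).transpose * chebVand N M) *ᵥ (c - b) =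
      (chebVand N M).transpose *ᵥ (y - chebVand N M *ᵥ b) := by
    rw [Matrix.mulVec_sub, Matrix.mulVec_sub, hc, Matrix.mulVec_mulVec]
  have hsum : ∑ i, P.eval (xequi N i) ^ 2 ≤ (N + 1) * D ^ 2 := by
    calc ∑ i, P.eval (xequi N i) ^ 2 = ∑ i, (chebVand N M *ᵥ (c - b)) i ^ 2 := by
          simp only [hmul, hPe, Pi.sub_apply, sub_mul, Finset.sum_sub_distrib]
      _ ≤ ∑ i, (y - chebVand N M *ᵥ b) i ^ 2 := Matrix.sum_mulVec_sq_le_of_normal_eq hnormal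
      _ ≤ ∑ _i : Fin (N + 1), D ^ 2 := by
          refine Finset.sum_le_sum fun i _ => ?_
          rw [Pi.sub_apply, hmul, ← sq_abs]
          gcongr
          exact hy i
      _ = (N + 1) * D ^ 2 := by simp
  have hbd := Polynomial.Chebyshev.abs_eval_iterate_derivative_le (P := P) 0 hx
    (by positivity : 0 < 12 * ((M : ℝ) + 1) * D) hdeg
    fun z hz => abs_eval_le_of_sum_sq_xequi_le hN hM hdeg hD.le hsum hz
  simp only [Function.iterate_zero, id] at hbd
  rw [abs_sub_comm, ← hPe]
  refine hbd.trans ?_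
  gcongr
  exact Polynomial.Chebyshev.eval_T_real_le_pow M hx

/-- **Oversampled regime** (Theorem 1.2, first part, of the paper): if
`log(Q/ε)/log ρ < √N / 2`, the degree-`M*` least squares Chebyshev fit
`e(x) = Σ c_k T_k(x)` with `M* = ⌊log(Q/ε)/log ρ⌋` computed from `ε`-perturbed
equally spaced samples of `f ∈ B_ρ(Q)` satisfies, for all `x ∈ [1, (ρ+ρ⁻¹)/2)`,
`|f(x) − e(x)| ≤ A (1 + log(Q/ε))^B (Q/(1−r)) (ε/Q)^{−log r / log ρ}`
with `r = (x+√(x²−1))/ρ` and constants `A, B` depending only on `ρ`. -/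
theorem oversampled_extrapolation (ρ : ℝ) (hρ : 1 < ρ) :
    ∃ A B : ℝ, 0 < A ∧ 0 < B ∧
      ∀ (Q ε : ℝ) (N : ℕ) (f : ℝ → ℝ) (a : ℕ → ℝ) (εvec : Fin (N + 1) → ℝ) (Mstar : ℕ)
        (c : Fin (Mstar + 1) → ℝ),
        0 < Q → 0 < ε → ε < Q → 0 < N →
        Real.log (Q / ε) / Real.log ρ < Real.sqrt (N : ℝ) / 2 →
        Mstar = ⌊Real.log (Q / ε) / Real.log ρ⌋₊ →
        (∀ x ∈ Set.Ico (-1 : ℝ) ((ρ + ρ⁻¹) / 2),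
          HasSum (fun n : ℕ => a n * cheb n x) (f x)) →
        |a 0| ≤ Q →
        (∀ n : ℕ, 1 ≤ n → |a n| ≤ 2 * Q * ρ ^ (-(n : ℤ))) →
        (∀ i, |εvec i| ≤ ε) →
        ((chebVand N Mstar).transpose * chebVand N Mstar) *ᵥ c =
          (chebVand N Mstar).transpose *ᵥ (fun i => f (xequi N i) + εvec i) →
        ∀ x ∈ Set.Ico (1 : ℝ) ((ρ + ρ⁻¹) / 2),
          |f x - ∑ k : Fin (Mstar + 1), c k * cheb (k : ℕ) x| ≤
            A * (1 + Real.log (Q / ε)) ^ B *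
              (Q / (1 - (x + Real.sqrt (x ^ 2 - 1)) / ρ)) *
              (ε / Q) ^ (-(Real.log ((x + Real.sqrt (x ^ 2 - 1)) / ρ) / Real.log ρ)) := by
  have hlogρ : 0 < Real.log ρ := Real.log_pos hρ
  have hρ0 : 0 < ρ := by linarith
  have hinv1 : ρ⁻¹ < 1 := inv_lt_one_of_one_lt₀ hρ
  have hinv0 : 0 < (1 - ρ⁻¹)⁻¹ := inv_pos.2 (by linarith)
  set D : ℝ := 2 * (1 - ρ⁻¹)⁻¹ + 1 with hD
  have hD0 : 0 < D := by positivity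
  refine ⟨2 + 12 * D * ρ * (1 + (Real.log ρ)⁻¹), 1, by positivity, one_pos, ?_⟩
  intro Q ε N f a εvec M c hQ hε hεQ hN hL hM hf _ ha hεvec hc x hx
  have hx1 : 1 ≤ x := hx.1
  set w := x + Real.sqrt (x ^ 2 - 1) with hw
  have hw1 : 1 ≤ w := by linarith [Real.sqrt_nonneg (x ^ 2 - 1)]
  have hwρ : w < ρ := add_sqrt_sq_sub_one_lt hρ hx1 hx.2
  set r := w / ρ with hr
  have hr0 : 0 < r := by positivity
  have hr1 : r < 1 := (div_lt_one hρ0).2 hwρ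
  have hlogQ : 0 < Real.log (Q / ε) := Real.log_pos ((one_lt_div hε).2 hεQ)
  set L := Real.log (Q / ε) / Real.log ρ with hLdef
  have hL0 : 0 < L := div_pos hlogQ hlogρ
  have hML : (M : ℝ) ≤ L := hM ▸ Nat.floor_le hL0.le
  have hLM : L < M + 1 := hM ▸ Nat.lt_floor_add_one L
  have hMN : 4 * (M : ℝ) ^ 2 < N := by
    have h1 : 2 * (M : ℝ) < √N := by linarith
    have h2 := (Real.lt_sqrt (by positivity)).1 h1
    linarith
  have hερ : ε = Q * ρ ^ (-L) := by
    rw [Real.rpow_def_of_pos hρ0, hLdef, mul_neg, mul_div_cancel₀ _ hlogρ.ne', Real.exp_neg,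
      Real.exp_log (by positivity)]
    field_simp
  have hrL : (ε / Q) ^ (-(Real.log r / Real.log ρ)) = r ^ L := by
    rw [Real.rpow_def_of_pos (by positivity), Real.rpow_def_of_pos hr0, hLdef,
      ← inv_div Q ε, Real.log_inv]
    congr 1
    ring
  have hρL : (1 / ρ) ^ (M + 1) ≤ ρ ^ (-L) := by
    rw [one_div, inv_pow, ← Real.rpow_natCast, ← Real.rpow_neg hρ0.le]
    exact Real.rpow_le_rpow_of_exponent_le hρ.le (by push_cast; linarith)
  have hrM : r ^ (M + 1) ≤ r ^ L := by
    rw [← Real.rpow_natCast]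
    exact Real.rpow_le_rpow_of_exponent_ge hr0 hr1.le (by push_cast; linarith)
  have hgrid : (1 : ℝ) < (ρ + ρ⁻¹) / 2 := by
    have : ρ * ρ⁻¹ = 1 := mul_inv_cancel₀ hρ0.ne'
    nlinarith
  have hy : ∀ i, |(f (xequi N i) + εvec i) - ∑ k : Fin (M + 1), a k * cheb k (xequi N i)| ≤
      D * ε := by
    intro i
    have hi := abs_xequi_le_one hN i
    have hi' := abs_le.1 hi
    have h := abs_sub_sum_mul_le_of_hasSum hQ hρ0 one_pos hρ ha
      (fun n => by rw [one_pow]; exact Polynomial.Chebyshev.abs_eval_T_real_le_one n hi)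
      (hf (xequi N i) ⟨hi'.1, by linarith⟩) M
    have h2 : 2 * Q * (1 / ρ) ^ (M + 1) * (1 - 1 / ρ)⁻¹ ≤ 2 * (1 - ρ⁻¹)⁻¹ * ε := by
      rw [hερ, one_div] at *
      calc 2 * Q * ρ⁻¹ ^ (M + 1) * (1 - ρ⁻¹)⁻¹ ≤ 2 * Q * ρ ^ (-L) * (1 - ρ⁻¹)⁻¹ := by gcongr
        _ = 2 * (1 - ρ⁻¹)⁻¹ * (Q * ρ ^ (-L)) := by ring
    rw [add_sub_right_comm]
    refine (abs_add_le _ _).trans ?_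
    rw [hD]
    linarith [hεvec i]
  have htail := abs_sub_sum_mul_le_of_hasSum hQ hρ0 (by linarith) hwρ ha (fun n => by
      have h := Polynomial.Chebyshev.one_le_eval_T_real n hx1
      rw [cheb, abs_of_nonneg (by linarith)]
      exact Polynomial.Chebyshev.eval_T_real_le_pow n hx1) (hf x ⟨by linarith, hx.2⟩) M
  have hfit := abs_sum_sub_sum_cheb_le hN hMN (by positivity) hy hc hx1
  rw [← hw] at hfit
  rw [← hr] at htail
  rw [hrL, Real.rpow_one]
  have hone : 1 ≤ (1 - r)⁻¹ := (one_le_inv₀ (by linarith)).2 (by linarith)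
  have hrL0 : 0 < r ^ L := Real.rpow_pos_of_pos hr0 L
  have hεw : ε * w ^ M ≤ Q * (ρ * r ^ L) := by
    have hwr : w = ρ * r := by rw [hr]; field_simp
    have h1 : ρ ^ (-L) * ρ ^ M ≤ 1 := by
      rw [← Real.rpow_natCast, ← Real.rpow_add hρ0]
      exact Real.rpow_le_one_of_one_le_of_nonpos hρ.le (by linarith)
    have h2 : r ^ M ≤ ρ * r ^ L := by
      have : 1 ≤ ρ * r := by rw [← hwr]; exact hw1
      calc r ^ M ≤ (ρ * r) * r ^ M := le_mul_of_one_le_left (by positivity) this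
        _ = ρ * r ^ (M + 1) := by ring
        _ ≤ ρ * r ^ L := by gcongr
    calc ε * w ^ M = Q * ((ρ ^ (-L) * ρ ^ M) * r ^ M) := by rw [hερ, hwr, mul_pow]; ring
      _ ≤ Q * (1 * (ρ * r ^ L)) := by gcongr
      _ = Q * (ρ * r ^ L) := by ring
  have hM1 : (M : ℝ) + 1 ≤ (1 + (Real.log ρ)⁻¹) * (1 + Real.log (Q / ε)) := by
    have h1 : L = (Real.log ρ)⁻¹ * Real.log (Q / ε) := by rw [hLdef]; field_simp
    have h2 := inv_pos.2 hlogρ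
    nlinarith
  set l := 1 + Real.log (Q / ε) with hl
  have hl1 : 1 ≤ l := by linarith
  calc |f x - ∑ k : Fin (M + 1), c k * cheb k x|
      ≤ 2 * Q * r ^ (M + 1) * (1 - r)⁻¹ + 12 * (M + 1) * (D * ε) * w ^ M :=
        (abs_sub_le _ _ _).trans (add_le_add htail hfit)
    _ = 2 * 1 * Q * r ^ (M + 1) * (1 - r)⁻¹ + 12 * D * (M + 1) * (ε * w ^ M) * 1 := by ring
    _ ≤ 2 * l * Q * r ^ L * (1 - r)⁻¹ +
        12 * D * ((1 + (Real.log ρ)⁻¹) * l) * (Q * (ρ * r ^ L)) * (1 - r)⁻¹ := by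
        have h0 : 0 ≤ (1 - r)⁻¹ := by linarith
        gcongr
    _ = (2 + 12 * D * ρ * (1 + (Real.log ρ)⁻¹)) * l * (Q / (1 - r)) * r ^ L := by
        rw [div_eq_mul_inv]; ring
end

section
/- Let M and N be nonnegative integers with M ≤ (1/2)√N, and let P_M(x^{equi}) be the (N+1)×(M+1) Legendre–Vandermonde matrix with (i,j) entry P_j(x_i^{equi}), where x_k^{equi} = 2k/N − 1. Then the largest singular value satisfies σ₁(P_M(x^{equi}))² ≤ 2N, and the smallest singular value satisfies σ_{M+1}(P_M(x^{equi}))² ≥ 2N/(5(2M+1)). Equivalently: ‖P_M(x^{equi}) v‖₂² ≤ 2N ‖v‖₂² and ‖P_M(x^{equi}) v‖₂² ≥ (2N/(5(2M+1))) ‖v‖₂² for every v ∈ ℝ^{M+1}. -/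
open Matrix MeasureTheory
open scoped BigOperators

/-- The Legendre polynomials, via the three-term recurrence
`(n+2) P_{n+2} = (2n+3) x P_{n+1} - (n+1) P_n`, normalized so that `P_n(1) = 1`. -/
noncomputable def legendre : ℕ → Polynomial ℝ
  | 0 => 1
  | 1 => Polynomial.X
  | n + 2 =>
      Polynomial.C ((2 * (n : ℝ) + 3) / ((n : ℝ) + 2)) * (Polynomial.X * legendre (n + 1)) -
        Polynomial.C (((n : ℝ) + 1) / ((n : ℝ) + 2)) * legendre n

/-- The `(N+1) × (M+1)` Legendre–Vandermonde matrix at the equally spaced grid. -/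
noncomputable def legVand (N M : ℕ) : Matrix (Fin (N + 1)) (Fin (M + 1)) ℝ :=
  Matrix.of fun i j => (legendre (j : ℕ)).eval (xequi N i)

/-- The law of a vector of `N+1` independent mean-zero Gaussians of variance `s²`. -/
noncomputable def gaussVec (N : ℕ) (s : ℝ) : Measure (Fin (N + 1) → ℝ) :=
  Measure.pi fun _ => ProbabilityTheory.gaussianReal 0 ⟨s ^ 2, sq_nonneg s⟩

open scoped Polynomial

theorem legendre_add_two (n : ℕ) :
    legendre (n + 2) =
      Polynomial.C ((2 * (n : ℝ) + 3) / ((n : ℝ) + 2)) * (Polynomial.X * legendre (n + 1)) -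
        Polynomial.C (((n : ℝ) + 1) / ((n : ℝ) + 2)) * legendre n := by
  rw [legendre]

/-- Bonnet's recurrence, cleared of denominators. -/
theorem bonnet_legendre (n : ℕ) :
    ((n : ℝ[X]) + 2) * legendre (n + 2) =
      (2 * (n : ℝ[X]) + 3) * (Polynomial.X * legendre (n + 1)) -
        ((n : ℝ[X]) + 1) * legendre n := by
  have h : (n : ℝ) + 2 ≠ 0 := by positivity
  have e : ((n : ℝ[X]) + 2) = Polynomial.C ((n : ℝ) + 2) := by
    simp only [Polynomial.C_add, map_natCast, Polynomial.C_ofNat]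
  have h1 : ((n : ℝ[X]) + 2) * Polynomial.C ((2 * (n : ℝ) + 3) / ((n : ℝ) + 2)) =
      2 * (n : ℝ[X]) + 3 := by
    rw [e, ← Polynomial.C_mul, mul_div_cancel₀ _ h]
    simp only [Polynomial.C_add, Polynomial.C_mul, map_natCast, Polynomial.C_ofNat]
  have h2 : ((n : ℝ[X]) + 2) * Polynomial.C (((n : ℝ) + 1) / ((n : ℝ) + 2)) =
      (n : ℝ[X]) + 1 := by
    rw [e, ← Polynomial.C_mul, mul_div_cancel₀ _ h]; simp
  rw [legendre_add_two]
  linear_combination (Polynomial.X * legendre (n + 1)) * h1 - legendre n * h2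

theorem legendre_eval_one (n : ℕ) : (legendre n).eval 1 = 1 := by
  induction n using Nat.twoStepInduction with
  | zero => simp [legendre]
  | one => simp [legendre]
  | more n h0 h1 =>
    rw [legendre_add_two]
    simp only [Polynomial.eval_sub, Polynomial.eval_mul, Polynomial.eval_C, Polynomial.eval_X,
      h0, h1]
    field_simp
    ring

theorem legendre_eval_neg_one (n : ℕ) : (legendre n).eval (-1) = (-1) ^ n := by
  induction n using Nat.twoStepInduction with
  | zero => simp [legendre]
  | one => simp [legendre]
  | more n h0 h1 =>
    rw [legendre_add_two]
    simp only [Polynomial.eval_sub, Polynomial.eval_mul, Polynomial.eval_C, Polynomial.eval_X,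
      h0, h1]
    field_simp
    ring

theorem derivative_legendre_succ_and (n : ℕ) :
    (legendre (n + 1)).derivative =
        Polynomial.X * (legendre n).derivative + ((n : ℝ[X]) + 1) * legendre n ∧
      Polynomial.X * (legendre (n + 1)).derivative - (legendre n).derivative =
        ((n : ℝ[X]) + 1) * legendre (n + 1) := by
  induction n with
  | zero => simp [legendre]
  | succ n ih =>
    obtain ⟨hA, hB⟩ := ih
    have hne : ((n : ℝ[X]) + 2) ≠ 0 := by exact_mod_cast Nat.succ_ne_zero (n + 1)
    have hb := bonnet_legendre n
    have hd := congrArg Polynomial.derivative hb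
    simp only [Polynomial.derivative_mul, Polynomial.derivative_sub, Polynomial.derivative_add,
      Polynomial.derivative_natCast, Polynomial.derivative_ofNat, Polynomial.derivative_one,
      Polynomial.derivative_X] at hd
    have hA' : (legendre (n + 2)).derivative =
        Polynomial.X * (legendre (n + 1)).derivative + ((n : ℝ[X]) + 2) * legendre (n + 1) := by
      apply mul_left_cancel₀ hne
      linear_combination hd + ((n : ℝ[X]) + 1) * hB
    push_cast
    refine ⟨by linear_combination hA', ?_⟩
    linear_combination Polynomial.X * hA' + Polynomial.X * hB - hA - hb

theorem derivative_legendre_succ (n : ℕ) :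
    (legendre (n + 1)).derivative =
      Polynomial.X * (legendre n).derivative + ((n : ℝ[X]) + 1) * legendre n :=
  (derivative_legendre_succ_and n).1

theorem X_mul_derivative_legendre_succ (n : ℕ) :
    Polynomial.X * (legendre (n + 1)).derivative - (legendre n).derivative =
      ((n : ℝ[X]) + 1) * legendre (n + 1) :=
  (derivative_legendre_succ_and n).2

theorem derivative_legendre_add_two (n : ℕ) :
    (legendre (n + 2)).derivative =
      (legendre n).derivative + (2 * (n : ℝ[X]) + 3) * legendre (n + 1) := by
  have h := derivative_legendre_succ (n + 1)
  push_cast at h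
  linear_combination h + X_mul_derivative_legendre_succ n

/-- The Legendre differential equation. -/
theorem legendre_ode (n : ℕ) :
    ((Polynomial.X ^ 2 - 1) * (legendre n).derivative).derivative =
      ((n : ℝ[X]) * ((n : ℝ[X]) + 1)) * legendre n := by
  cases n with
  | zero => simp [legendre]
  | succ n =>
    have hA := derivative_legendre_succ n
    have hB := X_mul_derivative_legendre_succ n
    have hC : (Polynomial.X ^ 2 - 1) * (legendre (n + 1)).derivative =
        ((n : ℝ[X]) + 1) * (Polynomial.X * legendre (n + 1) - legendre n) := by
      linear_combination Polynomial.X * hB - hA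
    rw [hC]
    simp only [Polynomial.derivative_mul, Polynomial.derivative_sub, Polynomial.derivative_add,
      Polynomial.derivative_natCast, Polynomial.derivative_one, Polynomial.derivative_X]
    push_cast
    linear_combination ((n : ℝ[X]) + 1) * hB

/-- Integration of polynomials over `[-1, 1]`. -/
noncomputable def legendreIntegral : ℝ[X] →ₗ[ℝ] ℝ where
  toFun p := ∫ x in (-1 : ℝ)..1, p.eval x
  map_add' p q := by
    simp only [Polynomial.eval_add]
    exact intervalIntegral.integral_add (p.continuous.intervalIntegrable _ _)
      (q.continuous.intervalIntegrable _ _)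
  map_smul' c p := by simp

theorem legendreIntegral_apply (p : ℝ[X]) :
    legendreIntegral p = ∫ x in (-1 : ℝ)..1, p.eval x := rfl

theorem legendreIntegral_derivative (p : ℝ[X]) :
    legendreIntegral p.derivative = p.eval 1 - p.eval (-1) :=
  intervalIntegral.integral_eq_sub_of_hasDerivAt (fun x _ => p.hasDerivAt x)
    (p.derivative.continuous.intervalIntegrable _ _)

theorem legendreIntegral_C_mul (c : ℝ) (p : ℝ[X]) :
    legendreIntegral (Polynomial.C c * p) = c * legendreIntegral p := by
  rw [← Polynomial.smul_eq_C_mul, map_smul, smul_eq_mul]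

theorem legendreIntegral_legendre_ode (j k : ℕ) :
    (j : ℝ) * (j + 1) * legendreIntegral (legendre j * legendre k) =
      -legendreIntegral ((Polynomial.X ^ 2 - 1) *
        ((legendre j).derivative * (legendre k).derivative)) := by
  have h := legendreIntegral_derivative
    ((Polynomial.X ^ 2 - 1) * (legendre j).derivative * legendre k)
  have e : ((Polynomial.X ^ 2 - 1) * (legendre j).derivative * legendre k).derivative =
      Polynomial.C ((j : ℝ) * (j + 1)) * (legendre j * legendre k) +
        (Polynomial.X ^ 2 - 1) * ((legendre j).derivative * (legendre k).derivative) := by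
    rw [Polynomial.derivative_mul, legendre_ode]
    simp only [Polynomial.C_mul, Polynomial.C_add, map_natCast, map_one]
    ring
  rw [e, map_add, legendreIntegral_C_mul] at h
  simp at h
  linarith

theorem legendreIntegral_mul_of_ne {j k : ℕ} (hjk : j ≠ k) :
    legendreIntegral (legendre j * legendre k) = 0 := by
  have h1 := legendreIntegral_legendre_ode j k
  have h2 := legendreIntegral_legendre_ode k j
  rw [mul_comm (legendre k), mul_comm (legendre k).derivative] at h2
  have h3 : ((j : ℝ) - k) * (j + k + 1) * legendreIntegral (legendre j * legendre k) = 0 := by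
    linear_combination h1 - h2
  have h4 : (j : ℝ) - k ≠ 0 := sub_ne_zero.mpr (by exact_mod_cast hjk)
  have h5 : (j : ℝ) + k + 1 ≠ 0 := by positivity
  exact (mul_eq_zero.mp h3).resolve_left (mul_ne_zero h4 h5)

theorem legendreIntegral_derivative_mul {j m : ℕ} (hjm : j ≤ m) :
    legendreIntegral ((legendre j).derivative * legendre m) = 0 := by
  induction j using Nat.twoStepInduction with
  | zero => simp [legendre]
  | one =>
    have := legendreIntegral_mul_of_ne (j := 0) (k := m) (by omega)
    simpa [legendre] using this
  | more n h0 _ =>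
    have e : (legendre (n + 2)).derivative * legendre m =
        (legendre n).derivative * legendre m +
          Polynomial.C (2 * (n : ℝ) + 3) * (legendre (n + 1) * legendre m) := by
      rw [derivative_legendre_add_two]
      simp only [Polynomial.C_mul, Polynomial.C_add, map_natCast, Polynomial.C_ofNat]
      ring
    rw [e, map_add, legendreIntegral_C_mul, h0 (by omega),
      legendreIntegral_mul_of_ne (by omega)]
    simp

theorem legendreIntegral_sq (n : ℕ) :
    legendreIntegral (legendre n * legendre n) = 2 / (2 * (n : ℝ) + 1) := by
  have h := legendreIntegral_derivative (Polynomial.X * (legendre n * legendre n))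
  have hX : legendreIntegral (Polynomial.X * (legendre n).derivative * legendre n) =
      n * legendreIntegral (legendre n * legendre n) := by
    cases n with
    | zero => simp [legendre]
    | succ n =>
      have e : Polynomial.X * (legendre (n + 1)).derivative * legendre (n + 1) =
          (legendre n).derivative * legendre (n + 1) +
            Polynomial.C ((n : ℝ) + 1) * (legendre (n + 1) * legendre (n + 1)) := by
        simp only [Polynomial.C_add, map_natCast, map_one]
        linear_combination legendre (n + 1) * X_mul_derivative_legendre_succ n
      rw [e, map_add, legendreIntegral_C_mul, legendreIntegral_derivative_mul (by omega)]
      push_cast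
      ring
  have e : (Polynomial.X * (legendre n * legendre n)).derivative =
      legendre n * legendre n +
        Polynomial.C 2 * (Polynomial.X * (legendre n).derivative * legendre n) := by
    simp only [Polynomial.derivative_mul, Polynomial.derivative_X, Polynomial.C_ofNat]
    ring
  rw [e, map_add, legendreIntegral_C_mul, hX] at h
  simp only [Polynomial.eval_mul, Polynomial.eval_X, legendre_eval_one,
    legendre_eval_neg_one] at h
  have hs : ((-1 : ℝ) ^ n) * (-1) ^ n = 1 := by rw [← mul_pow]; simp
  rw [hs] at h
  field_simp
  linarith

theorem legendreIntegral_derivative_sq (n : ℕ) :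
    legendreIntegral ((legendre n).derivative * (legendre n).derivative) = n * (n + 1) := by
  induction n using Nat.twoStepInduction with
  | zero => simp [legendre]
  | one => simp [legendre, legendreIntegral_apply]
  | more n h0 _ =>
    have e : (legendre (n + 2)).derivative * (legendre (n + 2)).derivative =
        (legendre n).derivative * (legendre n).derivative +
          (Polynomial.C (2 * (2 * (n : ℝ) + 3)) *
            ((legendre n).derivative * legendre (n + 1)) +
          Polynomial.C ((2 * (n : ℝ) + 3) ^ 2) * (legendre (n + 1) * legendre (n + 1))) := by
      rw [derivative_legendre_add_two]
      simp only [Polynomial.C_mul, Polynomial.C_add, Polynomial.C_pow, map_natCast,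
        Polynomial.C_ofNat]
      ring
    rw [e, map_add, map_add, legendreIntegral_C_mul, legendreIntegral_C_mul, h0,
      legendreIntegral_derivative_mul (by omega), legendreIntegral_sq]
    push_cast
    field_simp
    ring

theorem abs_trapezoid_sub_integral_le (q : ℝ[X]) {a b : ℝ} (hab : a ≤ b) :
    |(b - a) / 2 * (q.eval a + q.eval b) - ∫ x in a..b, q.eval x| ≤
      (b - a) / 2 * ∫ x in a..b, |q.derivative.eval x| := by
  set c := (a + b) / 2 with hc
  have hq : IntervalIntegrable (fun x => q.eval x) volume a b :=
    q.continuous.intervalIntegrable _ _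
  have hcont : Continuous fun x => (x - c) * q.derivative.eval x :=
    (continuous_id.sub continuous_const).mul q.derivative.continuous
  have key : ∫ x in a..b, (q.eval x + (x - c) * q.derivative.eval x) =
      (b - c) * q.eval b - (a - c) * q.eval a := by
    refine intervalIntegral.integral_eq_sub_of_hasDerivAt
      (f := fun x => (x - c) * q.eval x) (fun x _ => ?_)
      ((q.continuous.add hcont).intervalIntegrable _ _)
    have h : HasDerivAt (fun x => (x - c) * q.eval x) (1 * q.eval x + (x - c) *
        q.derivative.eval x) x := ((hasDerivAt_id x).sub_const c).mul (q.hasDerivAt x)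
    rwa [one_mul] at h
  rw [intervalIntegral.integral_add hq (hcont.intervalIntegrable _ _)] at key
  have e : (b - a) / 2 * (q.eval a + q.eval b) - ∫ x in a..b, q.eval x =
      ∫ x in a..b, (x - c) * q.derivative.eval x := by
    rw [hc] at key ⊢
    linarith
  rw [e, ← intervalIntegral.integral_const_mul]
  refine (intervalIntegral.abs_integral_le_integral_abs hab).trans ?_
  refine intervalIntegral.integral_mono_on hab (hcont.abs.intervalIntegrable _ _)
    ((continuous_const.mul q.derivative.continuous.abs).intervalIntegrable _ _) fun x hx => ?_
  rw [abs_mul]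
  gcongr
  rw [abs_le]
  constructor <;> linarith [hx.1, hx.2]

theorem abs_trapezoid_sum_sub_legendreIntegral_le (q : ℝ[X]) {N : ℕ} (hN : 0 < N) :
    |2 / (N : ℝ) * ∑ i, q.eval (xequi N i) - (q.eval 1 + q.eval (-1)) / N -
        legendreIntegral q| ≤
      1 / (N : ℝ) * ∫ x in (-1 : ℝ)..1, |q.derivative.eval x| := by
  have hN' : (N : ℝ) ≠ 0 := by positivity
  let a : ℕ → ℝ := fun k => 2 * (k : ℝ) / N - 1
  have hstep : ∀ k, a (k + 1) - a k = 2 / N := fun k => by simp only [a]; push_cast; ring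
  have ha0 : a 0 = -1 := by simp [a]
  have haN : a N = 1 := by simp only [a]; field_simp; ring
  have hint : ∀ f : ℝ → ℝ, Continuous f →
      ∑ k ∈ Finset.range N, ∫ x in a k..a (k + 1), f x = ∫ x in (-1 : ℝ)..1, f x := by
    intro f hf
    rw [intervalIntegral.sum_integral_adjacent_intervals
      (fun k _ => hf.intervalIntegrable _ _), ha0, haN]
  have hsum : ∑ i, q.eval (xequi N i) = ∑ k ∈ Finset.range (N + 1), q.eval (a k) :=
    Fin.sum_univ_eq_sum_range (fun k => q.eval (a k)) (N + 1)
  have hcells : 2 / (N : ℝ) * ∑ i, q.eval (xequi N i) - (q.eval 1 + q.eval (-1)) / N -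
      legendreIntegral q = ∑ k ∈ Finset.range N, ((a (k + 1) - a k) / 2 *
        (q.eval (a k) + q.eval (a (k + 1))) - ∫ x in a k..a (k + 1), q.eval x) := by
    have h1 := Finset.sum_range_succ (fun k => q.eval (a k)) N
    have h2 := Finset.sum_range_succ' (fun k => q.eval (a k)) N
    simp only [haN] at h1
    simp only [ha0] at h2
    simp only [hstep]
    rw [Finset.sum_sub_distrib, hint _ q.continuous, ← Finset.mul_sum, Finset.sum_add_distrib,
      hsum, legendreIntegral_apply]
    linear_combination (1 / (N : ℝ)) * (h1 + h2)
  rw [hcells]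
  refine (Finset.abs_sum_le_sum_abs _ _).trans ?_
  rw [← hint _ q.derivative.continuous.abs, Finset.mul_sum]
  refine Finset.sum_le_sum fun k _ => ?_
  have hle : a k ≤ a (k + 1) := by
    have : (0 : ℝ) ≤ 2 / N := by positivity
    linarith [hstep k]
  refine (abs_trapezoid_sub_integral_le q hle).trans (le_of_eq ?_)
  rw [hstep]
  ring

theorem integral_abs_derivative_sq_le (p : ℝ[X]) {s : ℝ} (hs : 0 < s) :
    ∫ x in (-1 : ℝ)..1, |(p * p).derivative.eval x| ≤
      s * legendreIntegral (p * p) + 1 / s * legendreIntegral (p.derivative * p.derivative) := by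
  rw [← legendreIntegral_C_mul, ← legendreIntegral_C_mul, ← map_add, legendreIntegral_apply]
  refine intervalIntegral.integral_mono_on (by norm_num)
    ((p * p).derivative.continuous.abs.intervalIntegrable _ _)
    ((Polynomial.continuous _).intervalIntegrable _ _) fun x _ => ?_
  simp only [Polynomial.derivative_mul, Polynomial.eval_add, Polynomial.eval_mul,
    Polynomial.eval_C]
  generalize p.eval x = u
  generalize p.derivative.eval x = w
  have h1 : 0 ≤ (s * u - w) ^ 2 / s := by positivity
  have h2 : 0 ≤ (s * u + w) ^ 2 / s := by positivity
  have e1 : (s * u - w) ^ 2 / s = s * (u * u) + 1 / s * (w * w) - 2 * u * w := by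
    field_simp; ring
  have e2 : (s * u + w) ^ 2 / s = s * (u * u) + 1 / s * (w * w) + 2 * u * w := by
    field_simp; ring
  rw [abs_le]
  constructor <;> linarith

/-- The polynomial with Legendre coefficients `v`. -/
noncomputable def legendreSeries {M : ℕ} (v : Fin (M + 1) → ℝ) : ℝ[X] :=
  ∑ j, Polynomial.C (v j) * legendre j

theorem legVand_mulVec_apply {N M : ℕ} (v : Fin (M + 1) → ℝ) (i : Fin (N + 1)) :
    (legVand N M).mulVec v i = (legendreSeries v).eval (xequi N i) := by
  simp only [legVand, legendreSeries, Matrix.mulVec, dotProduct, Matrix.of_apply,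
    Polynomial.eval_finsetSum, Polynomial.eval_mul, Polynomial.eval_C]
  exact Finset.sum_congr rfl fun j _ => mul_comm _ _

theorem enorm2_sq {n : ℕ} (v : Fin n → ℝ) : enorm2 v ^ 2 = ∑ i, v i ^ 2 :=
  Real.sq_sqrt (Finset.sum_nonneg fun _ _ => sq_nonneg _)

theorem enorm2_nonneg {n : ℕ} (v : Fin n → ℝ) : 0 ≤ enorm2 v := Real.sqrt_nonneg _

theorem enorm2_legVand_mulVec_sq {N M : ℕ} (v : Fin (M + 1) → ℝ) :
    enorm2 ((legVand N M).mulVec v) ^ 2 =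
      ∑ i, (legendreSeries v * legendreSeries v).eval (xequi N i) := by
  rw [enorm2_sq]
  simp only [legVand_mulVec_apply, Polynomial.eval_mul, sq]

theorem legendreIntegral_legendreSeries_sq {M : ℕ} (v : Fin (M + 1) → ℝ) :
    legendreIntegral (legendreSeries v * legendreSeries v) =
      ∑ j, v j ^ 2 * (2 / (2 * (j : ℝ) + 1)) := by
  rw [legendreSeries, Finset.sum_mul_sum, map_sum]
  refine Finset.sum_congr rfl fun j _ => ?_
  have e : ∀ k : Fin (M + 1), legendreIntegral
      (Polynomial.C (v j) * legendre j * (Polynomial.C (v k) * legendre k)) =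
        v j * v k * legendreIntegral (legendre j * legendre k) := fun k => by
    rw [mul_mul_mul_comm, ← Polynomial.C_mul, legendreIntegral_C_mul]
  rw [map_sum, Finset.sum_eq_single j, e, legendreIntegral_sq]
  · ring
  · intro k _ hk
    rw [e, legendreIntegral_mul_of_ne (Fin.val_ne_of_ne hk.symm), mul_zero]
  · simp

/-- An `L²` Markov inequality, obtained by applying Cauchy–Schwarz to the Legendre expansion. -/
theorem legendreIntegral_derivative_legendreSeries_sq_le {M : ℕ} (v : Fin (M + 1) → ℝ) :
    legendreIntegral ((legendreSeries v).derivative * (legendreSeries v).derivative) ≤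
      (M * (M + 1) ^ 2 * (M + 2) / 4 : ℝ) *
        legendreIntegral (legendreSeries v * legendreSeries v) := by
  set S := legendreIntegral (legendreSeries v * legendreSeries v) with hS
  rw [legendreIntegral_legendreSeries_sq] at hS
  let r : ℝ[X] := ∑ j : Fin (M + 1), Polynomial.C ((2 * (j : ℝ) + 1) / 2) *
    ((legendre j).derivative * (legendre j).derivative)
  have hr : legendreIntegral r = M * (M + 1) ^ 2 * (M + 2) / 4 := by
    simp only [r, map_sum, legendreIntegral_C_mul, legendreIntegral_derivative_sq]
    rw [Fin.sum_univ_eq_sum_range (fun j => (2 * (j : ℝ) + 1) / 2 * (j * (j + 1))) (M + 1)]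
    clear * -
    induction M with
    | zero => simp
    | succ n ih =>
      rw [Finset.sum_range_succ, ih]
      push_cast
      ring
  rw [← hr, mul_comm (legendreIntegral r), ← legendreIntegral_C_mul, legendreIntegral_apply,
    legendreIntegral_apply (_ * r)]
  refine intervalIntegral.integral_mono_on (by norm_num)
    ((Polynomial.continuous _).intervalIntegrable _ _)
    ((Polynomial.continuous _).intervalIntegrable _ _) fun x _ => ?_
  have hx : (legendreSeries v).derivative.eval x =
      ∑ j, v j * (legendre j).derivative.eval x := by
    simp [legendreSeries, Polynomial.eval_finsetSum]
  simp only [r, Polynomial.eval_mul, Polynomial.eval_C, Polynomial.eval_finsetSum]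
  rw [hx, ← sq, hS]
  refine Finset.sum_sq_le_sum_mul_sum_of_sq_le_mul _ (fun j _ => by positivity)
    (fun j _ => mul_nonneg (by positivity) (mul_self_nonneg _)) fun j _ => le_of_eq ?_
  field_simp

theorem legendreSeries_eval_one_sq_le {M : ℕ} (v : Fin (M + 1) → ℝ) :
    (legendreSeries v).eval 1 ^ 2 ≤ (M + 1) * enorm2 v ^ 2 := by
  have h := sq_sum_le_card_mul_sum_sq (s := Finset.univ) (f := v)
  simpa [legendreSeries, Polynomial.eval_finsetSum, legendre_eval_one, enorm2_sq] using h

theorem legendreSeries_eval_neg_one_sq_le {M : ℕ} (v : Fin (M + 1) → ℝ) :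
    (legendreSeries v).eval (-1) ^ 2 ≤ (M + 1) * enorm2 v ^ 2 := by
  have h := sq_sum_le_card_mul_sum_sq (s := Finset.univ)
    (f := fun j : Fin (M + 1) => v j * (-1) ^ (j : ℕ))
  simpa [legendreSeries, Polynomial.eval_finsetSum, legendre_eval_neg_one, enorm2_sq, mul_pow,
    ← pow_mul, mul_comm _ 2] using h

theorem legendreIntegral_legendreSeries_sq_le {M : ℕ} (v : Fin (M + 1) → ℝ) :
    legendreIntegral (legendreSeries v * legendreSeries v) ≤ 2 * enorm2 v ^ 2 := by
  rw [legendreIntegral_legendreSeries_sq, enorm2_sq, Finset.mul_sum]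
  refine Finset.sum_le_sum fun j _ => ?_
  have : 2 / (2 * (j : ℝ) + 1) ≤ 2 := div_le_self (by norm_num) (by
    have : (0 : ℝ) ≤ j := by positivity
    linarith)
  nlinarith [sq_nonneg (v j)]

theorem le_legendreIntegral_legendreSeries_sq {M : ℕ} (v : Fin (M + 1) → ℝ) :
    2 / (2 * (M : ℝ) + 1) * enorm2 v ^ 2 ≤
      legendreIntegral (legendreSeries v * legendreSeries v) := by
  rw [legendreIntegral_legendreSeries_sq, enorm2_sq, Finset.mul_sum]
  refine Finset.sum_le_sum fun j _ => ?_
  rw [mul_comm]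
  have : (j : ℝ) ≤ M := by exact_mod_cast Fin.is_le j
  gcongr

theorem enorm2_legVand_mulVec_sq_bounds_of_two_le {M N : ℕ} (hM : 2 ≤ M)
    (hMN : 4 * (M : ℝ) ^ 2 ≤ N) (v : Fin (M + 1) → ℝ) :
    enorm2 ((legVand N M).mulVec v) ^ 2 ≤ 2 * (N : ℝ) * enorm2 v ^ 2 ∧
      2 * (N : ℝ) / (5 * (2 * (M : ℝ) + 1)) * enorm2 v ^ 2 ≤
        enorm2 ((legVand N M).mulVec v) ^ 2 := by
  have hM' : (2 : ℝ) ≤ M := by exact_mod_cast hM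
  have hM2 : 0 < (M : ℝ) ^ 2 := by positivity
  have hNpos : (0 : ℝ) < N := by linarith
  have ht := abs_trapezoid_sum_sub_legendreIntegral_le (legendreSeries v * legendreSeries v)
    (N := N) (by exact_mod_cast hNpos)
  have hd := integral_abs_derivative_sq_le (legendreSeries v) hM2
  have hm := legendreIntegral_derivative_legendreSeries_sq_le v
  have hu := legendreIntegral_legendreSeries_sq_le v
  have hl := le_legendreIntegral_legendreSeries_sq v
  have h1 := legendreSeries_eval_one_sq_le v
  have h2 := legendreSeries_eval_neg_one_sq_le v
  rw [← enorm2_legVand_mulVec_sq] at ht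
  simp only [Polynomial.eval_mul] at ht
  simp only [← sq] at ht hd hm hu hl
  set V := enorm2 v ^ 2
  set T := enorm2 ((legVand N M).mulVec v) ^ 2
  set S := legendreIntegral (legendreSeries v ^ 2)
  set J := ∫ x in (-1 : ℝ)..1, |(legendreSeries v ^ 2).derivative.eval x|
  set A := (legendreSeries v).eval 1 ^ 2
  set B := (legendreSeries v).eval (-1) ^ 2
  have hV : 0 ≤ V := sq_nonneg _
  have hA : 0 ≤ A := sq_nonneg _
  have hB : 0 ≤ B := sq_nonneg _
  have hS : 0 ≤ S := le_trans (by positivity) hl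
  have hK : (M * (M + 1) ^ 2 * (M + 2) / 4 : ℝ) ≤ 9 / 8 * (M : ℝ) ^ 4 := by
    have e1 : (M : ℝ) + 1 ≤ 3 / 2 * M := by linarith
    have e2 : (M : ℝ) + 2 ≤ 2 * M := by linarith
    calc (M * (M + 1) ^ 2 * (M + 2) / 4 : ℝ) ≤ M * (3 / 2 * M) ^ 2 * (2 * M) / 4 := by gcongr
      _ = 9 / 8 * (M : ℝ) ^ 4 := by ring
  have hJ : J ≤ 17 / 32 * N * S := by
    have hm' := hm.trans (mul_le_mul_of_nonneg_right hK hS)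
    calc J ≤ (M : ℝ) ^ 2 * S + 1 / (M : ℝ) ^ 2 * (9 / 8 * (M : ℝ) ^ 4 * S) := by
          refine hd.trans ?_
          gcongr
      _ = 17 / 32 * (4 * (M : ℝ) ^ 2) * S := by field_simp; ring
      _ ≤ 17 / 32 * N * S := by gcongr
  have ht' : |2 * T - (A + B) - N * S| ≤ J := by
    have e : 2 * T - (A + B) - N * S = N * (2 / N * T - (A + B) / N - S) := by
      field_simp
    rw [e, abs_mul, abs_of_pos hNpos]
    calc (N : ℝ) * |2 / N * T - (A + B) / N - S| ≤ N * (1 / N * J) := by gcongr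
      _ = J := by field_simp
  obtain ⟨hlo, hhi⟩ := abs_le.mp ht'
  constructor
  · have e1 : N * S ≤ N * (2 * V) := by gcongr
    have e2 : ((M : ℝ) + 1) * V ≤ N / 4 * V := by gcongr; nlinarith
    have e3 : 0 ≤ N * V := by positivity
    linarith
  · have e1 : N * (2 / (2 * (M : ℝ) + 1) * V) ≤ N * S := by gcongr
    have e2 : 2 * (N : ℝ) / (5 * (2 * (M : ℝ) + 1)) * V =
        1 / 5 * (N * (2 / (2 * (M : ℝ) + 1) * V)) := by field_simp
    have e3 : 0 ≤ N * S := by positivity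
    linarith

theorem sum_xequi {N : ℕ} (hN : 0 < N) : ∑ i, xequi N i = 0 := by
  have hN' : (N : ℝ) ≠ 0 := by positivity
  have h : ∀ n : ℕ, ∑ k ∈ Finset.range n, (2 * (k : ℝ) / N - 1) = n * (n - 1) / N - n := by
    intro n
    induction n with
    | zero => simp
    | succ n ih => rw [Finset.sum_range_succ, ih]; push_cast; field_simp; ring
  refine (Fin.sum_univ_eq_sum_range (fun k => 2 * (k : ℝ) / N - 1) (N + 1)).trans ?_
  rw [h]
  push_cast
  field_simp
  ring

theorem sum_xequi_sq {N : ℕ} (hN : 0 < N) :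
    ∑ i, xequi N i ^ 2 = ((N : ℝ) + 1) * (N + 2) / (3 * N) := by
  have hN' : (N : ℝ) ≠ 0 := by positivity
  have h : ∀ n : ℕ, ∑ k ∈ Finset.range n, (2 * (k : ℝ) / N - 1) ^ 2 =
      4 * ((n : ℝ) * (n - 1) * (2 * n - 1) / 6) / N ^ 2 - 2 * (n * (n - 1)) / N + n := by
    intro n
    induction n with
    | zero => simp
    | succ n ih => rw [Finset.sum_range_succ, ih]; push_cast; field_simp; ring
  refine (Fin.sum_univ_eq_sum_range (fun k => (2 * (k : ℝ) / N - 1) ^ 2) (N + 1)).trans ?_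
  rw [h]
  push_cast
  field_simp
  ring

theorem enorm2_legVand_zero_mulVec_sq {N : ℕ} (v : Fin (0 + 1) → ℝ) :
    enorm2 ((legVand N 0).mulVec v) ^ 2 = ((N : ℝ) + 1) * enorm2 v ^ 2 := by
  simp [enorm2_sq, legVand_mulVec_apply, legendreSeries, legendre]

theorem enorm2_legVand_one_mulVec_sq {N : ℕ} (hN : 0 < N) (v : Fin (1 + 1) → ℝ) :
    enorm2 ((legVand N 1).mulVec v) ^ 2 =
      ((N : ℝ) + 1) * v 0 ^ 2 + ((N : ℝ) + 1) * (N + 2) / (3 * N) * v 1 ^ 2 := by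
  have e : ∀ i : Fin (N + 1), (legVand N 1).mulVec v i ^ 2 =
      v 0 ^ 2 + 2 * v 0 * v 1 * xequi N i + v 1 ^ 2 * xequi N i ^ 2 := fun i => by
    rw [legVand_mulVec_apply]
    simp [legendreSeries, legendre]
    ring
  simp only [enorm2_sq, e]
  rw [Finset.sum_add_distrib, Finset.sum_add_distrib, ← Finset.mul_sum, ← Finset.mul_sum,
    sum_xequi hN, sum_xequi_sq hN]
  simp
  ring

theorem enorm2_legVand_mulVec_sq_bounds {M N : ℕ} (hN : 0 < N)
    (hMN : 4 * (M : ℝ) ^ 2 ≤ N) (v : Fin (M + 1) → ℝ) :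
    enorm2 ((legVand N M).mulVec v) ^ 2 ≤ 2 * (N : ℝ) * enorm2 v ^ 2 ∧
      2 * (N : ℝ) / (5 * (2 * (M : ℝ) + 1)) * enorm2 v ^ 2 ≤
        enorm2 ((legVand N M).mulVec v) ^ 2 := by
  have hN1 : (1 : ℝ) ≤ N := by exact_mod_cast hN
  match M with
  | 0 =>
    rw [enorm2_legVand_zero_mulVec_sq]
    constructor
    · gcongr
      linarith
    · gcongr
      norm_num
      linarith
  | 1 =>
    rw [enorm2_legVand_one_mulVec_sq hN, enorm2_sq, Fin.sum_univ_two]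
    have hl : (N : ℝ) / 3 ≤ ((N : ℝ) + 1) * (N + 2) / (3 * N) := by
      rw [div_le_div_iff₀ (by norm_num) (by positivity)]
      nlinarith
    have hu : ((N : ℝ) + 1) * (N + 2) / (3 * N) ≤ 2 * N := by
      rw [div_le_iff₀ (by positivity)]
      nlinarith
    have h0 := sq_nonneg (v 0)
    have h1 := sq_nonneg (v 1)
    rw [mul_add (2 * (N : ℝ)), mul_add (_ / (5 * _))]
    constructor
    · gcongr
      linarith
    · refine add_le_add (mul_le_mul_of_nonneg_right ?_ h0) (mul_le_mul_of_nonneg_right ?_ h1) <;>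
        norm_num <;> linarith
  | M + 2 => exact enorm2_legVand_mulVec_sq_bounds_of_two_le (by omega) hMN v

/-- **Theorem 3.1 of the paper**: for `M ≤ √N / 2`, the extreme singular values of
the `(N+1) × (M+1)` Legendre–Vandermonde matrix at equally spaced points satisfy
`σ₁² ≤ 2N` and `σ_{M+1}² ≥ 2N/(5(2M+1))`; equivalently,
`(2N/(5(2M+1))) ‖v‖₂² ≤ ‖P_M(x^equi) v‖₂² ≤ 2N ‖v‖₂²` for every `v`. -/
theorem legendre_vandermonde_singular_values (M N : ℕ) (hN : 0 < N)
    (hMN : (M : ℝ) ≤ Real.sqrt (N : ℝ) / 2) :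
    sigmaMax (legVand N M) ^ 2 ≤ 2 * (N : ℝ) ∧
    2 * (N : ℝ) / (5 * (2 * (M : ℝ) + 1)) ≤ sigmaMin (legVand N M) ^ 2 ∧
    ∀ v : Fin (M + 1) → ℝ,
      enorm2 ((legVand N M).mulVec v) ^ 2 ≤ 2 * (N : ℝ) * enorm2 v ^ 2 ∧
      2 * (N : ℝ) / (5 * (2 * (M : ℝ) + 1)) * enorm2 v ^ 2 ≤
        enorm2 ((legVand N M).mulVec v) ^ 2 := by
  have hMN' : 4 * (M : ℝ) ^ 2 ≤ N := by
    have h := Real.sq_sqrt (Nat.cast_nonneg (α := ℝ) N)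
    have hM : (0 : ℝ) ≤ M := Nat.cast_nonneg M
    nlinarith [Real.sqrt_nonneg (N : ℝ)]
  have hb := fun v => enorm2_legVand_mulVec_sq_bounds hN hMN' v
  refine ⟨?_, ?_, hb⟩
  · have hle : sigmaMax (legVand N M) ≤ Real.sqrt (2 * N) := by
      refine Real.sSup_le ?_ (Real.sqrt_nonneg _)
      rintro r ⟨v, hv, rfl⟩
      refine Real.le_sqrt_of_sq_le ?_
      simpa [hv] using (hb v).1
    have hnonneg : 0 ≤ sigmaMax (legVand N M) := by
      refine Real.sSup_nonneg ?_
      rintro r ⟨v, -, rfl⟩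
      exact enorm2_nonneg _
    exact (Real.le_sqrt hnonneg (by positivity)).mp hle
  · have hle : Real.sqrt (2 * (N : ℝ) / (5 * (2 * (M : ℝ) + 1))) ≤ sigmaMin (legVand N M) := by
      refine le_csInf ⟨_, Pi.single 0 1, ?_, rfl⟩ ?_
      · simp [enorm2, Pi.single_apply]
      · rintro r ⟨v, hv, rfl⟩
        refine Real.sqrt_le_iff.mpr ⟨enorm2_nonneg _, ?_⟩
        simpa [hv] using (hb v).2
    exact (Real.sqrt_le_iff.mp hle).2
end

section
/- Let ρ > 1, Q > 0, and let integers M, N satisfy M ≤ (1/2)√N. Let f : [-1,1] → ℝ be given by a uniformly convergent Chebyshev series f(x) = Σ_{n≥0} a_n T_n(x) with |a_0| ≤ Q and |a_n| ≤ 2Q ρ^{-n} for n ≥ 1. Let c ∈ ℝ^{M+1} solve the normal equations T_M(x^{equi})ᵀ T_M(x^{equi}) c = T_M(x^{equi})ᵀ f(x^{equi}) and set p_M(x) = Σ_{k=0}^M c_k T_k(x). Then sup_{x ∈ [-1,1]} |f(x) − p_M(x)| ≤ 2Q [ 1 + 10√5 (M+1)^{3/2} ] · ρ^{-M}/(ρ−1).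 -/
open Matrix MeasureTheory
open scoped BigOperators

open Polynomial in
/-- The **Markov inequality** for the derivative at the endpoint `1`. -/
theorem abs_derivative_eval_one_le {n : ℕ} {P : ℝ[X]} {L : ℝ} (hL : 0 < L)
    (hdeg : P.degree ≤ n) (hP : ∀ x ∈ Set.Icc (-1 : ℝ) 1, |P.eval x| ≤ L) :
    |P.derivative.eval 1| ≤ (n : ℝ) ^ 2 * L := by
  have hT : (derivative^[1] (Chebyshev.T ℝ n)).eval 1 = (n : ℝ) ^ 2 := by
    simp [Chebyshev.T_derivative_eq_U, Chebyshev.U_eval_one, sq]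
  have key : ∀ s : ℝ, |s| = 1 → s * P.derivative.eval 1 ≤ (n : ℝ) ^ 2 * L := by
    intro s hs
    have h := Chebyshev.eval_iterate_derivative_le_of_forall_abs_le_one
      (n := n) (P := C (s / L) * P) (k := 1) le_rfl
      (natDegree_le_iff_degree_le.mp
        ((natDegree_C_mul_le _ _).trans (natDegree_le_iff_degree_le.mpr hdeg))) (fun x hx => by
        rw [eval_mul, eval_C, abs_mul, abs_div, hs, abs_of_pos hL, one_div, inv_mul_le_iff₀ hL]
        simpa using hP x hx)
    rw [hT] at h
    simp only [Function.iterate_one, derivative_C_mul, eval_mul, eval_C] at h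
    rwa [div_mul_eq_mul_div, div_le_iff₀ hL] at h
  refine abs_le.mpr ⟨?_, ?_⟩
  · linarith [key (-1) (by simp)]
  · linarith [key 1 (by simp)]

open Polynomial in
theorem abs_derivative_eval_le_of_nonneg {n : ℕ} {P : ℝ[X]} {L : ℝ} (hL : 0 < L)
    (hdeg : P.degree ≤ n) (hP : ∀ x ∈ Set.Icc (-1 : ℝ) 1, |P.eval x| ≤ L)
    {y : ℝ} (hy : y ∈ Set.Icc (0 : ℝ) 1) :
    |P.derivative.eval y| ≤ 2 * (n : ℝ) ^ 2 * L := by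
  obtain ⟨hy0, hy1⟩ := hy
  have hdeg' : (P.comp (C ((1 + y) / 2) * X + C ((y - 1) / 2))).degree ≤ n := by
    rw [← natDegree_le_iff_degree_le] at hdeg ⊢
    refine natDegree_comp_le.trans ?_
    calc _ ≤ P.natDegree * 1 := Nat.mul_le_mul_left _ natDegree_linear_le
      _ ≤ n := by simpa using hdeg
  have h := abs_derivative_eval_one_le hL hdeg' (fun x hx => by
    simp only [eval_comp, eval_add, eval_mul, eval_C, eval_X]
    exact hP _ ⟨by nlinarith [hx.1], by nlinarith [hx.2]⟩)
  rw [derivative_comp] at h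
  simp only [derivative_add, derivative_mul, derivative_C, derivative_X, eval_mul, eval_comp,
    eval_add, eval_C, eval_X, mul_one, zero_mul, zero_add, add_zero] at h
  rw [show (1 + y) / 2 + (y - 1) / 2 = y by ring, abs_mul,
    abs_of_nonneg (by linarith : (0 : ℝ) ≤ (1 + y) / 2)] at h
  nlinarith [abs_nonneg (P.derivative.eval y)]

open Polynomial in
/-- The Markov inequality on `[-1, 1]`, up to a factor of two. -/
theorem abs_derivative_eval_le {n : ℕ} {P : ℝ[X]} {L : ℝ} (hL : 0 < L)
    (hdeg : P.degree ≤ n) (hP : ∀ x ∈ Set.Icc (-1 : ℝ) 1, |P.eval x| ≤ L)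
    {y : ℝ} (hy : y ∈ Set.Icc (-1 : ℝ) 1) :
    |P.derivative.eval y| ≤ 2 * (n : ℝ) ^ 2 * L := by
  rcases le_total 0 y with h0 | h0
  · exact abs_derivative_eval_le_of_nonneg hL hdeg hP ⟨h0, hy.2⟩
  · have hdeg' : (P.comp (-X)).degree ≤ n := by
      rw [← natDegree_le_iff_degree_le] at hdeg ⊢
      simpa [natDegree_comp] using hdeg
    have h := abs_derivative_eval_le_of_nonneg hL hdeg' (fun x hx => by
      simpa [eval_comp] using hP (-x) ⟨by linarith [hx.2], by linarith [hx.1]⟩)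
      (y := -y) ⟨by linarith, by linarith [hy.1]⟩
    simpa [derivative_comp, eval_comp] using h

open Polynomial in
theorem abs_eval_sub_le {n : ℕ} {P : ℝ[X]} {L : ℝ} (hL : 0 < L)
    (hdeg : P.degree ≤ n) (hP : ∀ x ∈ Set.Icc (-1 : ℝ) 1, |P.eval x| ≤ L)
    {x y : ℝ} (hx : x ∈ Set.Icc (-1 : ℝ) 1) (hy : y ∈ Set.Icc (-1 : ℝ) 1) :
    |P.eval y - P.eval x| ≤ 2 * (n : ℝ) ^ 2 * L * |y - x| :=
  (convex_Icc (-1 : ℝ) 1).norm_image_sub_le_of_norm_hasDerivWithin_le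
    (fun z _ => (P.hasDerivAt z).hasDerivWithinAt)
    (fun _ hz => abs_derivative_eval_le hL hdeg hP hz) hx hy

theorem xequi_mem_Icc {N : ℕ} (hN : 0 < N) (k : Fin (N + 1)) :
    xequi N k ∈ Set.Icc (-1 : ℝ) 1 := by
  have hN' : (0 : ℝ) < N := by exact_mod_cast hN
  have hk : (k : ℝ) ≤ N := by exact_mod_cast Nat.lt_succ_iff.mp k.2
  have h0 : 0 ≤ 2 * (k : ℝ) / N := by positivity
  have h2 : 2 * (k : ℝ) / N ≤ 2 := by rw [div_le_iff₀ hN']; linarith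
  exact ⟨by unfold xequi; linarith, by unfold xequi; linarith⟩

theorem xequi_rev {N : ℕ} (hN : 0 < N) (k : Fin (N + 1)) :
    xequi N k.rev = -xequi N k := by
  have hN' : (N : ℝ) ≠ 0 := by exact_mod_cast hN.ne'
  have hk : (k : ℕ) ≤ N := Nat.lt_succ_iff.mp k.2
  have : ((k.rev : ℕ) : ℝ) = N - k := by
    rw [Fin.val_rev, Nat.add_sub_add_right, Nat.cast_sub hk]
  unfold xequi
  rw [this]
  field_simp
  ring

open Polynomial in
/-- Near a point of the left half where `|P|` is maximal there are at least `N / (16 n ^ 2)`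
grid points at which `|P|` is at least a quarter of its maximum. -/
theorem sq_mul_le_sum_sq_of_nonpos {n N : ℕ} (hn : 1 ≤ n) (hnN : 4 * n ^ 2 ≤ N)
    {P : ℝ[X]} {L : ℝ} (hL : 0 < L) (hdeg : P.degree ≤ n)
    (hP : ∀ x ∈ Set.Icc (-1 : ℝ) 1, |P.eval x| ≤ L)
    {x : ℝ} (hx : x ∈ Set.Icc (-1 : ℝ) 0) (hPx : |P.eval x| = L) :
    L ^ 2 * N ≤ 256 * (n : ℝ) ^ 2 * ∑ i : Fin (N + 1), P.eval (xequi N i) ^ 2 := by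
  have hn2 : 1 ≤ n ^ 2 := Nat.one_le_pow _ _ hn
  have hN : 0 < N := by omega
  have hN' : (0 : ℝ) < N := by exact_mod_cast hN
  have hn' : (1 : ℝ) ≤ (n : ℝ) ^ 2 := by exact_mod_cast hn2
  have hnN' : 4 * (n : ℝ) ^ 2 ≤ N := by exact_mod_cast hnN
  set u : ℝ := (x + 1) * N / 2 with hu
  have hu0 : 0 ≤ u := by have := hx.1; have : 0 ≤ x + 1 := by linarith
                         positivity
  have huN : u ≤ N / 2 := by rw [hu]; nlinarith [hx.2]
  set k₀ : ℕ := ⌊u + 1 / 2⌋₊ with hk₀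
  have hk1 : (k₀ : ℝ) ≤ u + 1 / 2 := Nat.floor_le (by linarith)
  have hk2 : u + 1 / 2 < k₀ + 1 := Nat.lt_floor_add_one _
  set m : ℕ := N / (16 * n ^ 2) with hm
  have hmN : m * (16 * n ^ 2) ≤ N := Nat.div_mul_le_self _ _
  have hmN' : (m : ℝ) * (16 * (n : ℝ) ^ 2) ≤ N := by exact_mod_cast hmN
  have hNm : N < (m + 1) * (16 * n ^ 2) := by
    have := Nat.lt_div_mul_add (a := N) (b := 16 * n ^ 2) (by omega)
    rw [hm]; linarith
  have hNm' : (N : ℝ) ≤ (m + 1) * (16 * (n : ℝ) ^ 2) := by exact_mod_cast hNm.le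
  have hk0N : k₀ + m ≤ N := by
    have : (k₀ : ℝ) + m < N + 1 := by nlinarith
    have : k₀ + m < N + 1 := by exact_mod_cast this
    omega
  have hpt : ∀ j ∈ Finset.range (m + 1),
      L ^ 2 / 16 ≤ P.eval (2 * ((k₀ + j : ℕ) : ℝ) / N - 1) ^ 2 := by
    intro j hj
    have hjm : j ≤ m := by simpa [Nat.lt_succ_iff] using hj
    have hjm' : (j : ℝ) ≤ m := by exact_mod_cast hjm
    have hmem := xequi_mem_Icc hN (⟨k₀ + j, by omega⟩ : Fin (N + 1))
    simp only [xequi] at hmem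
    have hd := abs_eval_sub_le hL hdeg hP ⟨hx.1, hx.2.trans zero_le_one⟩ hmem
    have hdist : |2 * ((k₀ + j : ℕ) : ℝ) / N - 1 - x| ≤ (1 + 2 * j) / N := by
      have : 2 * ((k₀ + j : ℕ) : ℝ) / N - 1 - x = 2 * (k₀ + j - u) / N := by
        rw [hu]; push_cast; field_simp; ring
      rw [this, abs_div, abs_of_pos hN']
      gcongr
      have hj0 : (0 : ℝ) ≤ j := by positivity
      rw [abs_le]; constructor <;> linarith
    have hsmall : 2 * (n : ℝ) ^ 2 * ((1 + 2 * j) / N) ≤ 3 / 4 := by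
      rw [← mul_div_assoc, div_le_iff₀ hN']
      nlinarith
    have hlip : |P.eval (2 * ((k₀ + j : ℕ) : ℝ) / N - 1) - P.eval x| ≤ 3 / 4 * L := by
      refine hd.trans ?_
      calc _ ≤ 2 * (n : ℝ) ^ 2 * L * ((1 + 2 * j) / N) := by gcongr
        _ = 2 * (n : ℝ) ^ 2 * ((1 + 2 * j) / N) * L := by ring
        _ ≤ _ := by gcongr
    have htri := abs_sub_abs_le_abs_sub (P.eval x) (P.eval (2 * ((k₀ + j : ℕ) : ℝ) / N - 1))
    rw [abs_sub_comm] at htri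
    have hbig : L / 4 ≤ |P.eval (2 * ((k₀ + j : ℕ) : ℝ) / N - 1)| := by linarith
    rw [← sq_abs (P.eval _)]
    nlinarith
  have hsum : (m + 1 : ℝ) * (L ^ 2 / 16) ≤ ∑ i : Fin (N + 1), P.eval (xequi N i) ^ 2 := by
    calc (m + 1 : ℝ) * (L ^ 2 / 16) = ∑ _j ∈ Finset.range (m + 1), L ^ 2 / 16 := by simp
      _ ≤ ∑ j ∈ Finset.range (m + 1), P.eval (2 * ((k₀ + j : ℕ) : ℝ) / N - 1) ^ 2 :=
        Finset.sum_le_sum hpt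
      _ = ∑ j ∈ Finset.Ico k₀ (k₀ + (m + 1)), P.eval (2 * (j : ℝ) / N - 1) ^ 2 := by
        rw [Finset.sum_Ico_eq_sum_range]; simp
      _ ≤ ∑ j ∈ Finset.range (N + 1), P.eval (2 * (j : ℝ) / N - 1) ^ 2 := by
        refine Finset.sum_le_sum_of_subset_of_nonneg ?_ (fun _ _ _ => sq_nonneg _)
        intro j hj
        simp only [Finset.mem_Ico, Finset.mem_range] at hj ⊢
        omega
      _ = _ := by rw [Finset.sum_range]; rfl
  calc L ^ 2 * N ≤ L ^ 2 * ((m + 1) * (16 * (n : ℝ) ^ 2)) := by gcongr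
    _ = 256 * (n : ℝ) ^ 2 * ((m + 1 : ℝ) * (L ^ 2 / 16)) := by ring
    _ ≤ _ := by gcongr

open Polynomial in
theorem sq_mul_le_sum_sq {n N : ℕ} (hn : 1 ≤ n) (hnN : 4 * n ^ 2 ≤ N)
    {P : ℝ[X]} {L : ℝ} (hL : 0 < L) (hdeg : P.degree ≤ n)
    (hP : ∀ x ∈ Set.Icc (-1 : ℝ) 1, |P.eval x| ≤ L)
    {x : ℝ} (hx : x ∈ Set.Icc (-1 : ℝ) 1) (hPx : |P.eval x| = L) :
    L ^ 2 * N ≤ 256 * (n : ℝ) ^ 2 * ∑ i : Fin (N + 1), P.eval (xequi N i) ^ 2 := by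
  rcases le_total x 0 with h0 | h0
  · exact sq_mul_le_sum_sq_of_nonpos hn hnN hL hdeg hP ⟨hx.1, h0⟩ hPx
  · have hN : 0 < N := by have := Nat.one_le_pow 2 n hn; omega
    have hdeg' : (P.comp (-X)).degree ≤ n := by
      rw [← natDegree_le_iff_degree_le] at hdeg ⊢
      simpa [natDegree_comp] using hdeg
    have h := sq_mul_le_sum_sq_of_nonpos hn hnN hL hdeg' (fun x hx => by
      simpa [eval_comp] using hP (-x) ⟨by linarith [hx.2], by linarith [hx.1]⟩)
      (x := -x) ⟨by linarith [hx.2], by linarith⟩ (by simpa [eval_comp] using hPx)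
    refine h.trans_eq ?_
    congr 1
    rw [← Equiv.sum_comp Fin.revPerm]
    simp [eval_comp, xequi_rev hN]

open Polynomial in
/-- The uniform norm of a polynomial of degree at most `√N / 2` is controlled by its mean square on
the equally spaced grid. -/
theorem eval_sq_mul_le_sum_sq {n N : ℕ} (hnN : 4 * n ^ 2 ≤ N)
    {P : ℝ[X]} (hdeg : P.degree ≤ n) {x : ℝ} (hx : x ∈ Set.Icc (-1 : ℝ) 1) :
    P.eval x ^ 2 * (N + 1) ≤
      500 * ((n : ℝ) + 1) ^ 3 * ∑ i : Fin (N + 1), P.eval (xequi N i) ^ 2 := by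
  have hS : 0 ≤ ∑ i : Fin (N + 1), P.eval (xequi N i) ^ 2 :=
    Finset.sum_nonneg fun _ _ => sq_nonneg _
  rcases Nat.eq_zero_or_pos n with rfl | hn
  · rw [eq_C_of_degree_le_zero (p := P) (by simpa using hdeg)]
    simp only [eval_C, Finset.sum_const, Finset.card_univ, Fintype.card_fin, nsmul_eq_mul]
    push_cast
    nlinarith [mul_nonneg (sq_nonneg (P.coeff 0)) (by positivity : (0 : ℝ) ≤ (N : ℝ) + 1)]
  obtain ⟨z, hz, hmax⟩ := isCompact_Icc.exists_isMaxOn (Set.nonempty_Icc.mpr (by norm_num))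
    (f := fun x => |P.eval x|) (s := Set.Icc (-1 : ℝ) 1) P.continuous.abs.continuousOn
  have hle : ∀ y ∈ Set.Icc (-1 : ℝ) 1, |P.eval y| ≤ |P.eval z| := fun y hy => hmax hy
  have hxz : P.eval x ^ 2 ≤ |P.eval z| ^ 2 := by
    rw [← sq_abs (P.eval x)]
    exact pow_le_pow_left₀ (abs_nonneg _) (hle x hx) 2
  rcases (abs_nonneg (P.eval z)).eq_or_lt with h0 | h0
  · rw [← h0] at hxz
    have : P.eval x ^ 2 = 0 := le_antisymm (by simpa using hxz) (sq_nonneg _)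
    rw [this, zero_mul]
    positivity
  have h := sq_mul_le_sum_sq hn hnN h0 hdeg hle hz rfl
  have hn' : (1 : ℝ) ≤ n := by exact_mod_cast hn
  have hN' : (1 : ℝ) ≤ N := by
    have : 1 ≤ N := by have := Nat.one_le_pow 2 n hn; omega
    exact_mod_cast this
  calc P.eval x ^ 2 * (N + 1) ≤ |P.eval z| ^ 2 * (N + N) := by gcongr
    _ = 2 * (|P.eval z| ^ 2 * N) := by ring
    _ ≤ 2 * (256 * (n : ℝ) ^ 2 * ∑ i : Fin (N + 1), P.eval (xequi N i) ^ 2) := by gcongr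
    _ = 512 * (n : ℝ) ^ 2 * ∑ i : Fin (N + 1), P.eval (xequi N i) ^ 2 := by ring
    _ ≤ _ := by
      gcongr ?_ * _
      nlinarith [mul_nonneg (sq_nonneg (n : ℝ)) (by linarith : (0 : ℝ) ≤ n - 1)]

/-- A solution of the normal equations `Aᵀ A d = Aᵀ r` satisfies `‖A d‖₂ ≤ ‖r‖₂`. -/
theorem sum_sq_mulVec_le {m n : Type*} [Fintype m] [Fintype n] (A : Matrix m n ℝ) (d : n → ℝ)
    (r : m → ℝ) (h : (Aᵀ * A) *ᵥ d = Aᵀ *ᵥ r) :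
    ∑ i, (A *ᵥ d) i ^ 2 ≤ ∑ i, r i ^ 2 := by
  have h1 : (A *ᵥ d) ⬝ᵥ (A *ᵥ d) = (A *ᵥ d) ⬝ᵥ r := by
    have h2 := congrArg (fun v => d ⬝ᵥ v) h
    simp only [← Matrix.mulVec_mulVec, Matrix.dotProduct_mulVec _ Aᵀ, Matrix.vecMul_transpose] at h2
    exact h2
  simp only [dotProduct, ← sq] at h1
  have h3 : 0 ≤ ∑ i, ((A *ᵥ d) i - r i) ^ 2 := Finset.sum_nonneg fun _ _ => sq_nonneg _
  have h4 : ∑ i, ((A *ᵥ d) i - r i) ^ 2 =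
      ∑ i, (A *ᵥ d) i ^ 2 - 2 * ∑ i, (A *ᵥ d) i * r i + ∑ i, r i ^ 2 := by
    rw [Finset.mul_sum, ← Finset.sum_sub_distrib, ← Finset.sum_add_distrib]
    exact Finset.sum_congr rfl fun _ _ => by ring
  linarith

theorem abs_cheb_le_one (n : ℕ) {x : ℝ} (hx : x ∈ Set.Icc (-1 : ℝ) 1) : |cheb n x| ≤ 1 :=
  Polynomial.Chebyshev.abs_eval_T_real_le_one n (abs_le.mpr hx)

/-- Truncation error of a geometrically decaying Chebyshev series. -/
theorem abs_sub_truncation_le {ρ Q : ℝ} (hρ : 1 < ρ) (M : ℕ) {a : ℕ → ℝ}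
    (ha : ∀ n : ℕ, 1 ≤ n → |a n| ≤ 2 * Q * ρ ^ (-(n : ℤ))) {x y : ℝ}
    (hx : x ∈ Set.Icc (-1 : ℝ) 1) (hf : HasSum (fun n : ℕ => a n * cheb n x) y) :
    |y - ∑ k : Fin (M + 1), a k * cheb k x| ≤ 2 * Q * (ρ ^ (-(M : ℤ)) / (ρ - 1)) := by
  have hρ0 : 0 < ρ := zero_lt_one.trans hρ
  have htail := (hasSum_nat_add_iff' (M + 1)).mpr hf
  rw [Finset.sum_range] at htail
  have hgeo : HasSum (fun n : ℕ => 2 * Q * ρ ^ (-((n + (M + 1) : ℕ) : ℤ)))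
      (2 * Q * (ρ ^ (-(M : ℤ)) / (ρ - 1))) := by
    have h := (hasSum_geometric_of_lt_one (inv_nonneg.mpr hρ0.le) (inv_lt_one_of_one_lt₀ hρ)).mul_left
      (2 * Q * (ρ ^ (M + 1))⁻¹)
    convert! h using 1
    · ext n
      rw [_root_.zpow_neg, zpow_natCast, pow_add, mul_inv, inv_pow]
      ring
    · have : ρ - 1 ≠ 0 := by linarith
      rw [_root_.zpow_neg, zpow_natCast, pow_succ]
      field_simp
  rw [← htail.tsum_eq]
  refine (Real.norm_eq_abs _).symm.trans_le (tsum_of_norm_bounded hgeo fun n => ?_)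
  rw [Real.norm_eq_abs, abs_mul]
  calc _ ≤ |a (n + (M + 1))| * 1 := by gcongr; exact abs_cheb_le_one _ hx
    _ ≤ _ := by rw [mul_one]; exact ha _ (by omega)

/-- **Inequality (4.2) of the paper**: if `M ≤ √N / 2`, `f(x) = Σ a_n T_n(x)` on
`[-1,1]` with `|a_0| ≤ Q`, `|a_n| ≤ 2Qρ^{-n}`, and `p_M = Σ c_k T_k` where `c` solves
the unperturbed normal equations at `N+1` equally spaced points, then
`sup_{x∈[-1,1]} |f(x) − p_M(x)| ≤ 2Q [1 + 10√5 (M+1)^{3/2}] ρ^{-M}/(ρ−1)`. -/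
theorem least_squares_geometric_convergence (ρ Q : ℝ) (hρ : 1 < ρ) (hQ : 0 < Q)
    (M N : ℕ) (hMN : (M : ℝ) ≤ Real.sqrt (N : ℝ) / 2)
    (f : ℝ → ℝ) (a : ℕ → ℝ)
    (hf : ∀ x ∈ Set.Icc (-1 : ℝ) 1, HasSum (fun n : ℕ => a n * cheb n x) (f x))
    (ha0 : |a 0| ≤ Q)
    (ha : ∀ n : ℕ, 1 ≤ n → |a n| ≤ 2 * Q * ρ ^ (-(n : ℤ)))
    (c : Fin (M + 1) → ℝ)
    (hc : ((chebVand N M).transpose * chebVand N M) *ᵥ c =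
      (chebVand N M).transpose *ᵥ (fun i => f (xequi N i))) :
    ∀ x ∈ Set.Icc (-1 : ℝ) 1,
      |f x - ∑ k : Fin (M + 1), c k * cheb (k : ℕ) x| ≤
        2 * Q * (1 + 10 * Real.sqrt 5 * ((M : ℝ) + 1) ^ ((3 : ℝ) / 2)) *
          (ρ ^ (-(M : ℤ)) / (ρ - 1)) := by
  intro x hx
  have hρ1 : 0 < ρ - 1 := by linarith
  have hnN : 4 * M ^ 2 ≤ N := by
    have h := pow_le_pow_left₀ (Nat.cast_nonneg M) hMN 2
    rw [div_pow, Real.sq_sqrt (Nat.cast_nonneg N)] at h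
    have h' : 4 * (M : ℝ) ^ 2 ≤ N := by linarith
    exact_mod_cast h'
  set E : ℝ := 2 * Q * (ρ ^ (-(M : ℤ)) / (ρ - 1)) with hE
  have hE0 : 0 ≤ E := by positivity
  have hgrid : ∀ i : Fin (N + 1), xequi N i ∈ Set.Icc (-1 : ℝ) 1 := by
    intro i
    rcases Nat.eq_zero_or_pos N with rfl | hN
    · simp [xequi]
    · exact xequi_mem_Icc hN i
  set d : Fin (M + 1) → ℝ := fun k => c k - a k with hd
  set P : Polynomial ℝ := ∑ k : Fin (M + 1),
    Polynomial.C (d k) * Polynomial.Chebyshev.T ℝ ((k : ℕ) : ℤ) with hPdef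
  have hPeval : ∀ y, P.eval y = ∑ k : Fin (M + 1), d k * cheb k y := by
    intro y
    simp [hPdef, Polynomial.eval_finsetSum, cheb]
  have hPdeg : P.degree ≤ M := by
    refine (Polynomial.degree_sum_le _ _).trans (Finset.sup_le fun k _ => ?_)
    refine Polynomial.natDegree_le_iff_degree_le.mp
      ((Polynomial.natDegree_C_mul_le _ _).trans ?_)
    rw [Polynomial.Chebyshev.natDegree_T]
    exact Nat.lt_succ_iff.mp k.2
  set r : Fin (N + 1) → ℝ := fun i =>
    f (xequi N i) - ∑ k : Fin (M + 1), a k * cheb k (xequi N i) with hr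
  have hr_le : ∀ i, |r i| ≤ E := fun i =>
    abs_sub_truncation_le hρ M ha (hgrid i) (hf _ (hgrid i))
  have hVd : ∀ i, (chebVand N M *ᵥ d) i = P.eval (xequi N i) := by
    intro i
    rw [hPeval]
    simp only [Matrix.mulVec, dotProduct, chebVand, Matrix.of_apply]
    exact Finset.sum_congr rfl fun _ _ => mul_comm _ _
  have hnormal : ((chebVand N M)ᵀ * chebVand N M) *ᵥ d = (chebVand N M)ᵀ *ᵥ r := by
    have hd' : d = c - fun k : Fin (M + 1) => a k := rfl
    have hr' : r = (fun i => f (xequi N i)) - chebVand N M *ᵥ fun k : Fin (M + 1) => a k := by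
      ext i
      exact congrArg (f (xequi N i) - ·) (Finset.sum_congr rfl fun k _ => mul_comm _ _)
    rw [hd', hr', Matrix.mulVec_sub, Matrix.mulVec_sub, hc, Matrix.mulVec_mulVec]
  have hsum : ∑ i : Fin (N + 1), P.eval (xequi N i) ^ 2 ≤ (N + 1) * E ^ 2 := by
    calc _ = ∑ i, (chebVand N M *ᵥ d) i ^ 2 := by simp only [hVd]
      _ ≤ ∑ i, r i ^ 2 := sum_sq_mulVec_le _ _ _ hnormal
      _ ≤ ∑ _i : Fin (N + 1), E ^ 2 := Finset.sum_le_sum fun i _ => by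
        rw [← sq_abs (r i)]
        exact pow_le_pow_left₀ (abs_nonneg _) (hr_le i) 2
      _ = _ := by simp
  have hPx : P.eval x ^ 2 ≤ 500 * ((M : ℝ) + 1) ^ 3 * E ^ 2 := by
    have h := eval_sq_mul_le_sum_sq hnN hPdeg hx
    have hN : (0 : ℝ) < (N : ℝ) + 1 := by positivity
    refine le_of_mul_le_mul_right (h.trans ?_) hN
    calc _ ≤ 500 * ((M : ℝ) + 1) ^ 3 * ((N + 1) * E ^ 2) := by gcongr
      _ = _ := by ring
  have hPabs : |P.eval x| ≤ 10 * Real.sqrt 5 * ((M : ℝ) + 1) ^ ((3 : ℝ) / 2) * E := by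
    refine abs_le_of_sq_le_sq (hPx.trans_eq ?_) (by positivity)
    have h5 : Real.sqrt 5 ^ 2 = 5 := Real.sq_sqrt (by norm_num)
    have hpow : (((M : ℝ) + 1) ^ ((3 : ℝ) / 2)) ^ 2 = ((M : ℝ) + 1) ^ 3 := by
      rw [← Real.rpow_natCast, ← Real.rpow_mul (by positivity), ← Real.rpow_natCast]
      norm_num
    calc 500 * ((M : ℝ) + 1) ^ 3 * E ^ 2
        = 10 ^ 2 * Real.sqrt 5 ^ 2 * (((M : ℝ) + 1) ^ ((3 : ℝ) / 2)) ^ 2 * E ^ 2 := by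
          rw [h5, hpow]; ring
      _ = _ := by ring
  have hsplit : f x - ∑ k : Fin (M + 1), c k * cheb (k : ℕ) x =
      (f x - ∑ k : Fin (M + 1), a k * cheb k x) - P.eval x := by
    rw [hPeval, sub_sub, ← Finset.sum_add_distrib]
    congr 1
    exact Finset.sum_congr rfl fun k _ => by rw [hd]; ring
  have htrunc := abs_sub_truncation_le hρ M ha hx (hf x hx)
  rw [hsplit]
  calc _ ≤ |f x - ∑ k : Fin (M + 1), a k * cheb k x| + |P.eval x| := abs_sub _ _
    _ ≤ E + 10 * Real.sqrt 5 * ((M : ℝ) + 1) ^ ((3 : ℝ) / 2) * E := add_le_add htrunc hPabs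
    _ = _ := by rw [hE]; ring
end
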